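/- arXiv:1402.5132 — 2 statements merged into one kernel-verified Lean document; each statement's English description precedes it below -/
import Mathlib

section
/- Let μ ∈ 𝓜_d and let s < t be two points of the support of μ. Then for every x ∈ ℝ and every u ∈ 𝓓[s,t], Φ_μ(s,x) ≥ F^{s,t}(u,x). -/
open MeasureTheory ProbabilityTheory Real Set Filter

noncomputable section

/-- `ξ(s) = ∑_{p≥2} β_p² s^p` (we use `β : ℕ → ℝ` with `β 0 = β 1 = 0`). -/
def xiFn (β : ℕ → ℝ) (s : ℝ) : ℝ := ∑' p : ℕ, β p ^ 2 * s ^ p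

/-- `ξ'(s)`. -/
def xiD (β : ℕ → ℝ) (s : ℝ) : ℝ := ∑' p : ℕ, (p : ℝ) * β p ^ 2 * s ^ (p - 1)

/-- `ζ(s) = ξ''(s)`. -/
def zetaFn (β : ℕ → ℝ) (s : ℝ) : ℝ :=
  ∑' p : ℕ, (p : ℝ) * ((p : ℝ) - 1) * β p ^ 2 * s ^ (p - 2)

/-- admissible sequence of temperature parameters -/
def ValidBeta (β : ℕ → ℝ) : Prop :=
  β 0 = 0 ∧ β 1 = 0 ∧ (∀ p, 0 ≤ β p) ∧ (∃ p, 2 ≤ p ∧ 0 < β p) ∧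
    Summable fun p : ℕ => (2 : ℝ) ^ p * β p ^ 2

/-- membership in `𝓜`: a Borel probability measure concentrated on `[0,1]` -/
def MemM (μ : Measure ℝ) : Prop := IsProbabilityMeasure μ ∧ μ (Icc (0 : ℝ) 1)ᶜ = 0

/-- member of `𝓜_d`: finitely supported -/
def FinSupp (μ : Measure ℝ) : Prop := ∃ S : Finset ℝ, μ ((S : Set ℝ))ᶜ = 0

/-- the distribution function `α(s) = μ([0,s])` -/
def distF (μ : Measure ℝ) (s : ℝ) : ℝ := (μ (Icc 0 s)).toReal

/-- the metric `d(μ,ν) = ∫_0^1 |μ([0,s]) - ν([0,s])| ds` -/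
def dM (μ ν : Measure ℝ) : ℝ := ∫ s in (0 : ℝ)..1, |distF μ s - distF ν s|

/-- the smallest atom of `μ` strictly after `s` (or `1` if there is none) -/
def nextPt (μ : Measure ℝ) (s : ℝ) : ℝ :=
  sInf ({q : ℝ | s < q ∧ q ≤ 1 ∧ μ {q} ≠ 0} ∪ {1})

/-- one step of the backward recursion defining the Parisi PDE solution:
`(1/m) log E exp (m Φ(t, x + z √(ξ'(t) - ξ'(s))))`, interpreted as
`E Φ(t, x + z √(ξ'(t) - ξ'(s)))` when `m = 0`. -/
def gStep (β : ℕ → ℝ) (Φ : ℝ → ℝ → ℝ) (m t s x : ℝ) : ℝ :=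
  if m = 0 then ∫ z, Φ t (x + z * Real.sqrt (xiD β t - xiD β s)) ∂(gaussianReal 0 1)
  else m⁻¹ * Real.log
    (∫ z, Real.exp (m * Φ t (x + z * Real.sqrt (xiD β t - xiD β s))) ∂(gaussianReal 0 1))

/-- `Φ` is the Parisi PDE solution of a finitely supported `μ`. -/
def IsAtomicSol (β : ℕ → ℝ) (μ : Measure ℝ) (Φ : ℝ → ℝ → ℝ) : Prop :=
  (∀ x : ℝ, Φ 1 x = Real.log (Real.cosh x)) ∧
  (∀ s ∈ Ico (0 : ℝ) 1, ∀ x : ℝ, Φ s x = gStep β Φ (distF μ s) (nextPt μ s) s x)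

/-- `Φ` is the Parisi family `μ ↦ Φ_μ`: it satisfies the backward recursion on `𝓜_d`
and is `d`-continuous on `𝓜` (uniformly in `(s,x) ∈ [0,1] × ℝ`). -/
def IsParisiFamily (β : ℕ → ℝ) (Φ : Measure ℝ → ℝ → ℝ → ℝ) : Prop :=
  (∀ μ, MemM μ → FinSupp μ → IsAtomicSol β μ (Φ μ)) ∧
  (∀ μ, MemM μ → ∀ ε : ℝ, 0 < ε → ∃ δ : ℝ, 0 < δ ∧ ∀ ν, MemM ν → dM μ ν < δ →
      ∀ s ∈ Icc (0 : ℝ) 1, ∀ x : ℝ, |Φ μ s x - Φ ν s x| < ε)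

/-- `B` is a standard Brownian motion under `P`. -/
def IsStdBM {Ω : Type*} [MeasurableSpace Ω] (P : Measure Ω) (B : ℝ → Ω → ℝ) : Prop :=
  (∀ t : ℝ, Measurable (B t)) ∧
  (∀ᵐ ω ∂P, B 0 ω = 0) ∧
  (∀ᵐ ω ∂P, Continuous fun t => B t ω) ∧
  (∀ s t : ℝ, 0 ≤ s → s ≤ t →
    Measure.map (fun ω => B t ω - B s ω) P = gaussianReal 0 (Real.toNNReal (t - s))) ∧
  (∀ s t : ℝ, 0 ≤ s → s ≤ t →
    Indep (MeasurableSpace.comap (fun ω => B t ω - B s ω) inferInstance)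
      (⨆ v ∈ Icc (0 : ℝ) s, MeasurableSpace.comap (B v) inferInstance) P)

/-- the space `𝓓[s,t]`: progressively measurable processes bounded by `1` on `[s,t]` -/
def InD {Ω : Type*} {mΩ : MeasurableSpace Ω} (𝓕 : Filtration ℝ mΩ) (s t : ℝ)
    (u : ℝ → Ω → ℝ) : Prop :=
  ProgMeasurable 𝓕 u ∧ ∀ r ∈ Icc s t, ∀ ω, |u r ω| ≤ 1

/-- the norm `‖u‖ = (E ∫_s^t u(r)² dr)^{1/2}` on `𝓓[s,t]` -/
def normD {Ω : Type*} [MeasurableSpace Ω] (P : Measure Ω) (s t : ℝ)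
    (u : ℝ → Ω → ℝ) : ℝ :=
  Real.sqrt (∫ ω, (∫ r in s..t, (u r ω) ^ 2) ∂P)

/-- the functional
`F^{s,t}(u,x) = E[Φ_μ(t, x + ∫_s^t α ζ u dr + W(t) - W(s)) - (1/2)∫_s^t α ζ u² dr]`,
where `W r = B (ξ' r)`. -/
def Ffn {Ω : Type*} [MeasurableSpace Ω] (P : Measure Ω) (β : ℕ → ℝ) (μ : Measure ℝ)
    (Φ : ℝ → ℝ → ℝ) (W : ℝ → Ω → ℝ) (s t : ℝ) (u : ℝ → Ω → ℝ) (x : ℝ) : ℝ :=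
  ∫ ω, (Φ t (x + (∫ r in s..t, distF μ r * zetaFn β r * u r ω) + (W t ω - W s ω))
      - (1 / 2) * ∫ r in s..t, distF μ r * zetaFn β r * (u r ω) ^ 2) ∂P


lemma gauss_exp_integrable {g : ℝ → ℝ} (hg : LipschitzWith 1 g) (m : ℝ) (x : ℝ) (v : NNReal) :
    Integrable (fun z => Real.exp (m * g z)) (gaussianReal x v) := by
  have h1 := integrable_exp_mul_gaussianReal (μ := x) (v := v) m
  have h2 := integrable_exp_mul_gaussianReal (μ := x) (v := v) (-m)
  refine Integrable.mono' ((h1.add h2).const_mul (Real.exp (|m| * |g 0|))) ?_ ?_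
  · exact (by have := hg.continuous; fun_prop : Continuous fun z => Real.exp (m * g z)).aestronglyMeasurable
  · refine Eventually.of_forall fun z => ?_
    have hb : |g z - g 0| ≤ |z| := by
      have := hg.dist_le_mul z 0
      simpa [Real.dist_eq] using this
    have hb2 : |g z| ≤ |g 0| + |z| := by
      have := abs_sub_abs_le_abs_sub (g z) (g 0); linarith
    have hb3 : m * g z ≤ |m| * |g 0| + |m * z| := by
      calc m * g z ≤ |m * g z| := le_abs_self _
        _ = |m| * |g z| := abs_mul _ _
        _ ≤ |m| * (|g 0| + |z|) := by gcongr
        _ = _ := by rw [abs_mul]; ring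
    rw [Real.norm_eq_abs, abs_of_pos (Real.exp_pos _)]
    calc Real.exp (m * g z) ≤ Real.exp (|m| * |g 0| + |m * z|) := Real.exp_le_exp.2 hb3
      _ = Real.exp (|m| * |g 0|) * Real.exp |m * z| := Real.exp_add _ _
      _ ≤ _ := by
        gcongr
        simp only [Pi.add_apply]
        have e1 := Real.exp_pos (m * z)
        have e2 := Real.exp_pos (-m * z)
        rcases abs_cases (m * z) with h | h
        · rw [h.1]; linarith
        · rw [h.1, ← neg_mul]; linarith

lemma lip_integrable {Ω : Type*} {mΩ : MeasurableSpace Ω} {P : Measure Ω} [IsFiniteMeasure P]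
    {g : ℝ → ℝ} (hg : LipschitzWith 1 g) {X : Ω → ℝ} (hX : Integrable X P) :
    Integrable (fun ω => g (X ω)) P := by
  refine Integrable.mono' ((integrable_const |g 0|).add hX.abs) ?_ ?_
  · exact hg.continuous.comp_aestronglyMeasurable hX.aestronglyMeasurable
  · refine Eventually.of_forall fun ω => ?_
    have hb : |g (X ω) - g 0| ≤ |X ω| := by
      have := hg.dist_le_mul (X ω) 0
      simpa [Real.dist_eq] using this
    have := abs_sub_abs_le_abs_sub (g (X ω)) (g 0)
    simp only [Pi.add_apply, Real.norm_eq_abs]; linarith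

lemma gauss_id_integrable (x : ℝ) (v : NNReal) : Integrable (fun z : ℝ => z) (gaussianReal x v) :=
  (memLp_id_gaussianReal (μ := x) (v := v) 1).integrable (by simp)

lemma gauss_lip_integrable {g : ℝ → ℝ} (hg : LipschitzWith 1 g) (x : ℝ) (v : NNReal) :
    Integrable g (gaussianReal x v) :=
  lip_integrable hg (gauss_id_integrable x v)

def Gop (m : ℝ) (v : NNReal) (g : ℝ → ℝ) (x : ℝ) : ℝ :=
  m⁻¹ * Real.log (∫ z, Real.exp (m * g z) ∂(gaussianReal x v))

lemma gauss_exp_pos {g : ℝ → ℝ} (hg : LipschitzWith 1 g) (m : ℝ) (x : ℝ) (v : NNReal) :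
    0 < ∫ z, Real.exp (m * g z) ∂(gaussianReal x v) :=
  integral_exp_pos (gauss_exp_integrable hg m x v)

lemma exp_Gop {g : ℝ → ℝ} (hg : LipschitzWith 1 g) {m : ℝ} (hm : 0 < m) (x : ℝ) (v : NNReal) :
    Real.exp (m * Gop m v g x) = ∫ z, Real.exp (m * g z) ∂(gaussianReal x v) := by
  unfold Gop
  rw [← mul_assoc, mul_inv_cancel₀ hm.ne', one_mul, Real.exp_log (gauss_exp_pos hg m x v)]

lemma gauss_integral_shift (f : ℝ → ℝ) (x : ℝ) (v : NNReal) :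
    ∫ z, f z ∂(gaussianReal x v) = ∫ z, f (x + z) ∂(gaussianReal 0 v) := by
  have h := gaussianReal_map_const_add (μ := 0) (v := v) x
  rw [zero_add] at h
  rw [← h, (measurableEmbedding_addLeft x).integral_map]

lemma Gop_lip {g : ℝ → ℝ} (hg : LipschitzWith 1 g) {m : ℝ} (hm : 0 < m) (v : NNReal) :
    LipschitzWith 1 (Gop m v g) := by
  refine LipschitzWith.of_le_add_mul 1 fun x y => ?_
  have key : Real.exp (m * Gop m v g x) ≤ Real.exp (m * (Gop m v g y + dist x y)) := by
    rw [mul_add, Real.exp_add, exp_Gop hg hm, exp_Gop hg hm, gauss_integral_shift _ x,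
      gauss_integral_shift _ y, ← integral_mul_const]
    have hs : ∀ x : ℝ, LipschitzWith 1 (fun z => g (x + z)) := fun x => by
      refine LipschitzWith.of_dist_le_mul fun a b => ?_
      have := hg.dist_le_mul (x + a) (x + b)
      simpa using this
    refine integral_mono (gauss_exp_integrable (hs x) m 0 v)
      ((gauss_exp_integrable (hs y) m 0 v).mul_const _) fun z => ?_
    dsimp only
    rw [← Real.exp_add, Real.exp_le_exp]
    have h1 := hg.dist_le_mul (x + z) (y + z)
    rw [dist_add_right, Real.dist_eq] at h1
    have h2 := (abs_le.1 h1).2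
    have : g (x + z) ≤ g (y + z) + dist x y := by
      simp at h2; linarith
    nlinarith
  have := Real.exp_le_exp.1 key
  have := le_of_mul_le_mul_left this hm
  simpa using this

lemma Gop_Gop {g : ℝ → ℝ} (hg : LipschitzWith 1 g) {m : ℝ} (hm : 0 < m) (v w : NNReal) (x : ℝ) :
    Gop m w (Gop m v g) x = Gop m (w + v) g x := by
  have key : Real.exp (m * Gop m w (Gop m v g) x) = Real.exp (m * Gop m (w + v) g x) := by
    rw [exp_Gop (Gop_lip hg hm v) hm, exp_Gop hg hm]
    simp_rw [exp_Gop hg hm]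
    have hc := gaussianReal_conv_gaussianReal (m₁ := x) (m₂ := 0) (v₁ := w) (v₂ := v)
    rw [add_zero] at hc
    have hi := gauss_exp_integrable hg m x (w + v)
    rw [← hc] at hi ⊢
    rw [integral_conv hi]
    simp_rw [← gauss_integral_shift (fun z => Real.exp (m * g z))]
  exact mul_left_cancel₀ hm.ne' (Real.exp_injective key)

/-- one-step inequality -/
lemma Gop_ge {g : ℝ → ℝ} (hg : LipschitzWith 1 g) {m : ℝ} (hm : 0 < m) {v : NNReal} (hv : v ≠ 0)
    (x D : ℝ) :
    (∫ z, g z ∂(gaussianReal (x + m * D) v)) - m / 2 * (D ^ 2 / v) ≤ Gop m v g x := by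
  have hv' : (0 : ℝ) < v := by positivity
  set l : ℝ := m * D / v with hl
  have hlv : l * v = m * D := by rw [hl]; field_simp
  have hpdf : ∀ z, gaussianPDFReal x v z
      = gaussianPDFReal (x + m * D) v z * Real.exp (-l * z + l * x + l ^ 2 * v / 2) := by
    intro z
    unfold gaussianPDFReal
    rw [mul_assoc (_⁻¹), ← Real.exp_add]
    congr 2
    rw [← hlv]
    field_simp
    ring
  have hE : ∫ z, Real.exp (m * g z) ∂(gaussianReal x v)
      = ∫ z, Real.exp (m * g z + (-l * z + l * x + l ^ 2 * v / 2)) ∂(gaussianReal (x + m * D) v) := by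
    rw [integral_gaussianReal_eq_integral_smul hv, integral_gaussianReal_eq_integral_smul hv]
    refine integral_congr_ae (Eventually.of_forall fun z => ?_)
    dsimp only
    rw [hpdf, Real.exp_add (m * g z), smul_eq_mul, smul_eq_mul]
    ring
  have hgi := gauss_lip_integrable hg (x + m * D) v
  have hid := gauss_id_integrable (x + m * D) v
  set N := gaussianReal (x + m * D) v
  have a1 : Integrable (fun z => m * g z) N := hgi.const_mul m
  have a2 : Integrable (fun z => -l * z) N := hid.const_mul (-l)
  have a3 : Integrable (fun z => -l * z + l * x) N := a2.add (integrable_const _)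
  have a4 : Integrable (fun z => -l * z + l * x + l ^ 2 * v / 2) N := a3.add (integrable_const _)
  have i1 : Integrable (fun z => m * g z + (-l * z + l * x + l ^ 2 * v / 2)) N := a1.add a4
  have i2 : Integrable (fun z => Real.exp (m * g z + (-l * z + l * x + l ^ 2 * v / 2))) N := by
    by_contra hcon
    rw [integral_undef hcon] at hE
    exact (gauss_exp_pos hg m x v).ne' hE
  have jen := convexOn_exp.map_integral_le continuous_exp.continuousOn isClosed_univ
    (Eventually.of_forall fun _ => mem_univ _) i1 i2
  have hval : ∫ z, (m * g z + (-l * z + l * x + l ^ 2 * v / 2)) ∂N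
      = m * ((∫ z, g z ∂N) - m / 2 * (D ^ 2 / v)) := by
    rw [integral_add a1 a4, integral_add a3 (integrable_const _), integral_add a2 (integrable_const _),
      integral_const_mul, integral_const_mul, integral_id_gaussianReal]
    simp only [integral_const, probReal_univ, one_smul]
    have : m * (m / 2 * (D ^ 2 / v)) = l ^ 2 * v / 2 := by
      rw [hl]; field_simp
    rw [mul_sub, this, ← hlv]
    ring
  rw [hval, ← hE, ← exp_Gop hg hm] at jen
  exact le_of_mul_le_mul_left (Real.exp_le_exp.1 jen) hm

lemma heat_lip {g : ℝ → ℝ} (hg : LipschitzWith 1 g) (v : NNReal) :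
    LipschitzWith 1 (fun y => ∫ z, g z ∂(gaussianReal y v)) := by
  refine LipschitzWith.of_le_add_mul 1 fun x y => ?_
  have hs : ∀ x : ℝ, LipschitzWith 1 (fun z => g (x + z)) := fun x => by
    refine LipschitzWith.of_dist_le_mul fun a b => ?_
    have := hg.dist_le_mul (x + a) (x + b)
    simpa using this
  have hi : ∀ x, Integrable (fun z => g (x + z)) (gaussianReal 0 v) :=
    fun x => gauss_lip_integrable (hs x) 0 v
  rw [gauss_integral_shift _ x, gauss_integral_shift _ y]
  have : ∫ z, g (x + z) ∂(gaussianReal 0 v) ≤ ∫ z, (g (y + z) + dist x y) ∂(gaussianReal 0 v) := by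
    refine integral_mono (hi x) ((hi y).add (integrable_const _)) fun z => ?_
    have h1 := hg.dist_le_mul (x + z) (y + z)
    rw [dist_add_right, Real.dist_eq] at h1
    have h2 := (abs_le.1 h1).2
    simp at h2
    dsimp only
    linarith
  rw [integral_add (hi y) (integrable_const _)] at this
  simpa using this

lemma step_ineq {Ω : Type*} {𝓖 : MeasurableSpace Ω} {mΩ : MeasurableSpace Ω} {P : Measure Ω}
    [IsProbabilityMeasure P]
    (h𝓖 : 𝓖 ≤ mΩ) {g : ℝ → ℝ} (hg : LipschitzWith 1 g) {m : ℝ} (hm : 0 < m)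
    {v : NNReal} (hv : v ≠ 0) {X D Q Z : Ω → ℝ} (hX : Measurable[𝓖] X) (hXi : Integrable X P)
    (hD : Measurable[𝓖] D) (hDi : Integrable D P) (hQ : Integrable Q P)
    (hDQ : ∀ ω, D ω ^ 2 ≤ v * Q ω) (hZm : Measurable Z)
    (hZ : P.map Z = gaussianReal 0 v) (hind : Indep (MeasurableSpace.comap Z inferInstance) 𝓖 P) :
    (∫ ω, g (X ω + m * D ω + Z ω) ∂P) - m / 2 * ∫ ω, Q ω ∂P ≤ ∫ ω, Gop m v g (X ω) ∂P := by
  have hv' : (0 : ℝ) < v := by positivity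
  have hYm : Measurable[𝓖] (fun ω => X ω + m * D ω) := hX.add (hD.const_mul m)
  have hYm' : Measurable (fun ω => X ω + m * D ω) := hYm.mono h𝓖 le_rfl
  have hYi : Integrable (fun ω => X ω + m * D ω) P := hXi.add (hDi.const_mul m)
  set Y := fun ω => X ω + m * D ω with hY
  have hZi : Integrable Z P := by
    have := gauss_id_integrable 0 v
    rw [← hZ] at this
    exact (integrable_map_measure (g := fun z : ℝ => z)
      continuous_id.aestronglyMeasurable hZm.aemeasurable).1 this
  have hYZ : IndepFun Y Z P := by
    rw [IndepFun_iff_Indep]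
    exact indep_of_indep_of_le_left hind.symm hYm.comap_le
  have hmap := hYZ.map_add_eq_map_conv_map₀ hYm'.aemeasurable hZm.aemeasurable
  have hgYZ : Integrable (fun ω => g (Y ω + Z ω)) P := lip_integrable hg (hYi.add hZi)
  have hgm : Integrable g (P.map (Y + Z)) :=
    (integrable_map_measure hg.continuous.aestronglyMeasurable (hYm'.add hZm).aemeasurable).2 hgYZ
  have hhl := heat_lip hg v
  have e1 : ∫ ω, g (Y ω + Z ω) ∂P = ∫ ω, (∫ z, g z ∂(gaussianReal (Y ω) v)) ∂P := by
    have : ∫ ω, g (Y ω + Z ω) ∂P = ∫ y, g y ∂(P.map (Y + Z)) := by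
      rw [integral_map (hYm'.add hZm).aemeasurable hg.continuous.aestronglyMeasurable]
      rfl
    rw [this, hmap]
    rw [hmap] at hgm
    rw [integral_conv hgm, hZ]
    simp_rw [← gauss_integral_shift g]
    rw [integral_map hYm'.aemeasurable hhl.continuous.aestronglyMeasurable]
  have i1 : Integrable (fun ω => ∫ z, g z ∂(gaussianReal (Y ω) v)) P := lip_integrable hhl hYi
  have i2 : Integrable (fun ω => Gop m v g (X ω)) P := lip_integrable (Gop_lip hg hm v) hXi
  rw [e1, ← integral_const_mul, ← integral_sub i1 (hQ.const_mul _)]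
  refine integral_mono (i1.sub (hQ.const_mul _)) i2 fun ω => ?_
  have h1 := Gop_ge hg hm hv (X ω) (D ω)
  have h2 : D ω ^ 2 / v ≤ Q ω := by rw [div_le_iff₀ hv', mul_comm]; exact hDQ ω
  have h3 : m / 2 * (D ω ^ 2 / v) ≤ m / 2 * Q ω := by gcongr
  simp only [hY]
  linarith

lemma sq_le_two_pow (p : ℕ) : (p : ℝ) ^ 2 ≤ 4 * 2 ^ p := by
  induction p with
  | zero => norm_num
  | succ n ih =>
    by_cases h : n < 3
    · interval_cases n <;> norm_num
    · have h3 : (3 : ℝ) ≤ n := by exact_mod_cast not_lt.1 h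
      push_cast
      rw [pow_succ (2 : ℝ)]
      nlinarith

lemma summable_sq {β : ℕ → ℝ} (hβ : ValidBeta β) : Summable fun p : ℕ => (p : ℝ) ^ 2 * β p ^ 2 := by
  obtain ⟨_, _, _, _, hs⟩ := hβ
  refine Summable.of_nonneg_of_le (fun p => by positivity) (fun p => ?_) (hs.mul_left 4)
  have := sq_le_two_pow p
  have := mul_le_mul_of_nonneg_right this (sq_nonneg (β p))
  linarith

lemma xiD_term_le {β : ℕ → ℝ} (p : ℕ) {s : ℝ} (hs : s ∈ Icc (0 : ℝ) 1) :
    ‖(p : ℝ) * β p ^ 2 * s ^ (p - 1)‖ ≤ (p : ℝ) ^ 2 * β p ^ 2 := by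
  have h1 : (p : ℝ) ≤ (p : ℝ) ^ 2 := by exact_mod_cast Nat.le_self_pow two_ne_zero p
  have h2 : s ^ (p - 1) ≤ 1 := pow_le_one₀ hs.1 hs.2
  have h3 : 0 ≤ s ^ (p - 1) := pow_nonneg hs.1 _
  rw [Real.norm_eq_abs, abs_of_nonneg (by positivity)]
  calc (p : ℝ) * β p ^ 2 * s ^ (p - 1) ≤ (p : ℝ) ^ 2 * β p ^ 2 * 1 := by gcongr
    _ = _ := mul_one _

lemma pp_nonneg (p : ℕ) : 0 ≤ (p : ℝ) * ((p : ℝ) - 1) := by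
  rcases Nat.eq_zero_or_pos p with rfl | h
  · simp
  · have : (1 : ℝ) ≤ p := by exact_mod_cast h
    have : 0 ≤ (p : ℝ) - 1 := by linarith
    positivity

lemma zeta_term_nonneg {β : ℕ → ℝ} (p : ℕ) {s : ℝ} (hs : s ∈ Icc (0 : ℝ) 1) :
    0 ≤ (p : ℝ) * ((p : ℝ) - 1) * β p ^ 2 * s ^ (p - 2) :=
  mul_nonneg (mul_nonneg (pp_nonneg p) (sq_nonneg _)) (pow_nonneg hs.1 _)

lemma zeta_term_le {β : ℕ → ℝ} (p : ℕ) {s : ℝ} (hs : s ∈ Icc (0 : ℝ) 1) :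
    ‖(p : ℝ) * ((p : ℝ) - 1) * β p ^ 2 * s ^ (p - 2)‖ ≤ (p : ℝ) ^ 2 * β p ^ 2 := by
  have h1 : (p : ℝ) * ((p : ℝ) - 1) ≤ (p : ℝ) ^ 2 := by nlinarith [Nat.cast_nonneg (α := ℝ) p]
  have h2 : s ^ (p - 2) ≤ 1 := pow_le_one₀ hs.1 hs.2
  have h3 : 0 ≤ s ^ (p - 2) := pow_nonneg hs.1 _
  rw [Real.norm_eq_abs, abs_of_nonneg (zeta_term_nonneg p hs)]
  calc (p : ℝ) * ((p : ℝ) - 1) * β p ^ 2 * s ^ (p - 2) ≤ (p : ℝ) ^ 2 * β p ^ 2 * 1 := by gcongr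
    _ = _ := mul_one _

lemma xiD_contOn {β : ℕ → ℝ} (hβ : ValidBeta β) : ContinuousOn (xiD β) (Icc 0 1) :=
  continuousOn_tsum (fun p => by fun_prop) (summable_sq hβ) fun p _ hs => xiD_term_le p hs

lemma zeta_contOn {β : ℕ → ℝ} (hβ : ValidBeta β) : ContinuousOn (zetaFn β) (Icc 0 1) :=
  continuousOn_tsum (fun p => by fun_prop) (summable_sq hβ) fun p _ hs => zeta_term_le p hs

lemma zeta_nonneg {β : ℕ → ℝ} {s : ℝ} (hs : s ∈ Icc (0 : ℝ) 1) : 0 ≤ zetaFn β s :=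
  tsum_nonneg fun p => zeta_term_nonneg p hs

lemma xiD_nonneg {β : ℕ → ℝ} {s : ℝ} (hs : s ∈ Icc (0 : ℝ) 1) : 0 ≤ xiD β s :=
  tsum_nonneg fun p => by have := hs.1; positivity

lemma xiD_summable {β : ℕ → ℝ} (hβ : ValidBeta β) {s : ℝ} (hs : s ∈ Icc (0 : ℝ) 1) :
    Summable fun p : ℕ => (p : ℝ) * β p ^ 2 * s ^ (p - 1) :=
  Summable.of_norm_bounded (summable_sq hβ) fun p => xiD_term_le p hs

lemma xiD_strictMonoOn {β : ℕ → ℝ} (hβ : ValidBeta β) : StrictMonoOn (xiD β) (Icc 0 1) := by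
  intro a ha b hb hab
  obtain ⟨_, _, _, ⟨p, hp, hpos⟩, _⟩ := id hβ
  refine Summable.tsum_lt_tsum (i := p) (fun q => ?_) ?_ (xiD_summable hβ ha) (xiD_summable hβ hb)
  · have := pow_le_pow_left₀ ha.1 hab.le (q - 1)
    gcongr
  · have := pow_lt_pow_left₀ hab ha.1 (n := p - 1) (by omega)
    have : (0 : ℝ) < p := by exact_mod_cast (by omega : 0 < p)
    gcongr

lemma integral_zeta {β : ℕ → ℝ} (hβ : ValidBeta β) {a b : ℝ} (ha : 0 ≤ a) (hab : a ≤ b)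
    (hb : b ≤ 1) : ∫ r in a..b, zetaFn β r = xiD β b - xiD β a := by
  have hsub : uIcc a b ⊆ Icc 0 1 := by
    rw [uIcc_of_le hab]; exact Icc_subset_Icc ha hb
  have h := intervalIntegral.hasSum_integral_of_dominated_convergence (μ := volume) (a := a) (b := b)
    (F := fun (p : ℕ) r => (p : ℝ) * ((p : ℝ) - 1) * β p ^ 2 * r ^ (p - 2)) (f := zetaFn β)
    (fun p _ => (p : ℝ) ^ 2 * β p ^ 2)
    (fun p => (by fun_prop : Continuous fun r : ℝ =>
      (p : ℝ) * ((p : ℝ) - 1) * β p ^ 2 * r ^ (p - 2)).aestronglyMeasurable)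
    (fun p => Eventually.of_forall fun r hr => zeta_term_le p (hsub (uIoc_subset_uIcc hr)))
    (Eventually.of_forall fun r hr => summable_sq hβ)
    (intervalIntegrable_const)
    (Eventually.of_forall fun r hr => (Summable.of_norm_bounded (summable_sq hβ)
      fun p => zeta_term_le p (hsub (uIoc_subset_uIcc hr))).hasSum)
  have h2 := (xiD_summable hβ (s := b) ⟨ha.trans hab, hb⟩).hasSum.sub
    (xiD_summable hβ (s := a) ⟨ha, hab.trans hb⟩).hasSum
  have hfun : (fun p : ℕ => ∫ r in a..b, (p : ℝ) * ((p : ℝ) - 1) * β p ^ 2 * r ^ (p - 2))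
      = fun p : ℕ => (p : ℝ) * β p ^ 2 * b ^ (p - 1) - (p : ℝ) * β p ^ 2 * a ^ (p - 1) := by
    funext p
    rw [intervalIntegral.integral_const_mul, integral_pow]
    rcases p with _ | _ | p
    · simp
    · simp
    · have : ((p : ℝ) + 1) ≠ 0 := by positivity
      simp only [Nat.cast_add, Nat.cast_one, Nat.add_sub_cancel, show p + 1 + 1 - 2 = p by omega]
      field_simp
      ring
  rw [hfun] at h
  exact h.unique h2

lemma interval_abs {Ω : Type*} {mΩ : MeasurableSpace Ω} {P : Measure Ω} [IsProbabilityMeasure P]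
    {𝓕 : Filtration ℝ mΩ} {κ : ℝ → ℝ} {a b : ℝ} (hab : a < b)
    (hκc : ContinuousOn κ (Icc a b)) (hκm : StrictMonoOn κ (Icc a b))
    {W : ℝ → Ω → ℝ} (hWm : ∀ r ∈ Icc a b, Measurable[𝓕 r] (W r))
    (hWl : ∀ p ∈ Icc a b, ∀ q ∈ Icc a b, p ≤ q →
      P.map (fun ω => W q ω - W p ω) = gaussianReal 0 (Real.toNNReal (κ q - κ p)))
    (hWi : ∀ p ∈ Icc a b, ∀ q ∈ Icc a b, p ≤ q →
      Indep (MeasurableSpace.comap (fun ω => W q ω - W p ω) inferInstance) (𝓕 p) P)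
    {I J : ℝ → Ω → ℝ} (hI0 : ∀ ω, I a ω = 0) (hJ0 : ∀ ω, J a ω = 0)
    (hIm : ∀ r ∈ Icc a b, Measurable[𝓕 r] (I r)) (hJm : ∀ r ∈ Icc a b, Measurable[𝓕 r] (J r))
    (hIl : ∀ p ∈ Icc a b, ∀ q ∈ Icc a b, p ≤ q → ∀ ω, |I q ω - I p ω| ≤ κ q - κ p)
    (hJl : ∀ p ∈ Icc a b, ∀ q ∈ Icc a b, p ≤ q → ∀ ω, |J q ω - J p ω| ≤ κ q - κ p)
    (hJp : ∀ p ∈ Icc a b, ∀ q ∈ Icc a b, p ≤ q → ∀ ω, J p ω ≤ J q ω)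
    (hCS : ∀ p ∈ Icc a b, ∀ q ∈ Icc a b, p ≤ q → ∀ ω,
      (I q ω - I p ω) ^ 2 ≤ (κ q - κ p) * (J q ω - J p ω))
    {g : ℝ → ℝ} (hg : LipschitzWith 1 g) {m : ℝ} (hm : 0 < m)
    {X : Ω → ℝ} (hX : Measurable[𝓕 a] X) (hXi : Integrable X P) :
    (∫ ω, g (X ω + m * I b ω + (W b ω - W a ω)) ∂P) - m / 2 * ∫ ω, J b ω ∂P
      ≤ ∫ ω, Gop m (Real.toNNReal (κ b - κ a)) g (X ω) ∂P := by
  have haI : a ∈ Icc a b := ⟨le_rfl, hab.le⟩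
  have hbI : b ∈ Icc a b := ⟨hab.le, le_rfl⟩
  have hIi : ∀ r ∈ Icc a b, Integrable (I r) P := fun r hr => by
    refine Integrable.of_bound (((hIm r hr).mono (𝓕.le r) le_rfl).aestronglyMeasurable) (κ r - κ a)
      (Eventually.of_forall fun ω => ?_)
    simpa [hI0] using hIl a haI r hr hr.1 ω
  have hJi : ∀ r ∈ Icc a b, Integrable (J r) P := fun r hr => by
    refine Integrable.of_bound (((hJm r hr).mono (𝓕.le r) le_rfl).aestronglyMeasurable) (κ r - κ a)
      (Eventually.of_forall fun ω => ?_)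
    simpa [hJ0] using hJl a haI r hr hr.1 ω
  have hWmm : ∀ p ∈ Icc a b, ∀ q ∈ Icc a b, Measurable (fun ω => W q ω - W p ω) :=
    fun p hp q hq => ((hWm q hq).mono (𝓕.le q) le_rfl).sub ((hWm p hp).mono (𝓕.le p) le_rfl)
  have hWint : ∀ r ∈ Icc a b, Integrable (fun ω => W r ω - W a ω) P := fun r hr => by
    have := gauss_id_integrable 0 (Real.toNNReal (κ r - κ a))
    rw [← hWl a haI r hr hr.1] at this
    exact (integrable_map_measure (g := fun z : ℝ => z)
      continuous_id.aestronglyMeasurable (hWmm a haI r hr).aemeasurable).1 this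
  set K := κ b - κ a with hK
  have hKpos : 0 < K := sub_pos.2 (hκm haI hbI hab)
  set RHS := ∫ ω, Gop m (Real.toNNReal K) g (X ω) ∂P with hRHS
  -- discretized bound
  have main : ∀ n : ℕ, (∫ ω, g (X ω + m * I b ω + (W b ω - W a ω)) ∂P) - m / 2 * ∫ ω, J b ω ∂P
      ≤ RHS + m * K * (1 / ((n : ℝ) + 1)) := by
    intro n
    set N : ℕ := n + 1 with hN
    have hNr : (N : ℝ) = n + 1 := by rw [hN]; push_cast; ring
    have hNpos : (0 : ℝ) < N := by rw [hNr]; positivity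
    set Δ : ℝ := K / N with hΔ
    have hΔpos : 0 < Δ := by positivity
    have hNΔ : N * Δ = K := by rw [hΔ]; field_simp
    have hex : ∀ k : ℕ, ∃ τ ∈ Icc a b, k ≤ N → κ τ = κ a + k * Δ := by
      intro k
      by_cases hk : k ≤ N
      · have hmem : κ a + k * Δ ∈ Icc (κ a) (κ b) := by
          have hk' : (k : ℝ) ≤ N := by exact_mod_cast hk
          constructor
          · have : 0 ≤ (k : ℝ) * Δ := by positivity
            linarith
          · have : (k : ℝ) * Δ ≤ N * Δ := by gcongr
            linarith
        obtain ⟨τ, hτ, h⟩ := intermediate_value_Icc hab.le hκc hmem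
        exact ⟨τ, hτ, fun _ => h⟩
      · exact ⟨a, haI, fun h => absurd h hk⟩
    choose t htI ht using hex
    have ht0 : t 0 = a := hκm.injOn (htI 0) haI (by rw [ht 0 (by omega)]; simp)
    have htN : t N = b := hκm.injOn (htI N) hbI (by rw [ht N le_rfl, hNΔ, hK]; ring)
    have hstep : ∀ k, k < N → κ (t (k + 1)) - κ (t k) = Δ := fun k hk => by
      rw [ht k hk.le, ht (k + 1) hk]; push_cast; ring
    have hmono : ∀ k, k < N → t k ≤ t (k + 1) := fun k hk => by
      by_contra hcon
      have := hκm (htI _) (htI _) (not_le.1 hcon)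
      have := hstep k hk
      linarith
    set d : ℕ → ℝ := fun k => t (k - 1) with hd
    have hdI : ∀ k, d k ∈ Icc a b := fun k => htI _
    have hdt : ∀ k, k ≤ N → d k ≤ t k ∧ κ (t k) - κ (d k) ≤ Δ := by
      intro k hk
      rcases k with _ | k
      · simp only [hd]; exact ⟨le_rfl, by simp [hΔpos.le]⟩
      · simp only [hd, Nat.add_sub_cancel]
        exact ⟨hmono k hk, (hstep k hk).le⟩
    have ind : ∀ k, k ≤ N →
        (∫ ω, Gop m (Real.toNNReal (κ b - κ (t k))) g
          (X ω + m * I (d k) ω + (W (t k) ω - W a ω)) ∂P) - m / 2 * ∫ ω, J (d k) ω ∂P ≤ RHS := by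
      intro k
      induction k with
      | zero =>
        intro _
        simp [hd, ht0, hI0, hJ0, hRHS, hK]
      | succ k ih =>
        intro hk
        have hk' : k < N := hk
        have ih := ih hk'.le
        obtain ⟨h1, h2⟩ := hdt k hk'.le
        have hvv : ((Real.toNNReal Δ : NNReal) : ℝ) = Δ := Real.coe_toNNReal _ hΔpos.le
        have ha' : a ≤ t k := (htI k).1
        have hma : ∀ r, r ≤ t k → 𝓕 r ≤ 𝓕 (t k) := fun r hr => 𝓕.mono hr
        have hIdm : Measurable[𝓕 (t k)] (I (d k)) := (hIm _ (hdI k)).mono (hma _ h1) le_rfl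
        have hGl := Gop_lip hg hm (Real.toNNReal (κ b - κ (t (k + 1))))
        have hst := step_ineq (P := P) (𝓖 := 𝓕 (t k)) (𝓕.le _) hGl hm
          (v := Real.toNNReal Δ) (by simpa using hΔpos)
          (X := fun ω => X ω + m * I (d k) ω + (W (t k) ω - W a ω))
          (D := fun ω => I (t k) ω - I (d k) ω) (Q := fun ω => J (t k) ω - J (d k) ω)
          (Z := fun ω => W (t (k + 1)) ω - W (t k) ω)
          (((hX.mono (hma _ ha') le_rfl).add (hIdm.const_mul m)).add
            ((hWm _ (htI k)).sub ((hWm _ haI).mono (hma _ ha') le_rfl)))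
          ((hXi.add ((hIi _ (hdI k)).const_mul m)).add (hWint _ (htI k)))
          ((hIm _ (htI k)).sub hIdm) ((hIi _ (htI k)).sub (hIi _ (hdI k)))
          ((hJi _ (htI k)).sub (hJi _ (hdI k)))
          (fun ω => by
            rw [hvv]
            refine (hCS _ (hdI k) _ (htI k) h1 ω).trans ?_
            have := hJp _ (hdI k) _ (htI k) h1 ω
            exact mul_le_mul_of_nonneg_right h2 (by linarith))
          (hWmm _ (htI k) _ (htI (k + 1)))
          (by rw [hWl _ (htI k) _ (htI (k + 1)) (hmono k hk'), hstep k hk'])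
          (hWi _ (htI k) _ (htI (k + 1)) (hmono k hk'))
        have hkb : κ (t (k + 1)) ≤ κ b := hκm.monotoneOn (htI _) hbI (htI _).2
        have hvar : Real.toNNReal Δ + Real.toNNReal (κ b - κ (t (k + 1)))
            = Real.toNNReal (κ b - κ (t k)) := by
          rw [← Real.toNNReal_add hΔpos.le (by linarith)]
          congr 1
          have := hstep k hk'
          linarith
        simp_rw [Gop_Gop hg hm, hvar] at hst
        rw [integral_sub (hJi _ (htI k)) (hJi _ (hdI k))] at hst
        have hdk : d (k + 1) = t k := by simp [hd]
        rw [hdk]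
        have harg : ∀ ω, X ω + m * I (d k) ω + (W (t k) ω - W a ω) + m * (I (t k) ω - I (d k) ω)
            + (W (t (k + 1)) ω - W (t k) ω) = X ω + m * I (t k) ω + (W (t (k + 1)) ω - W a ω) :=
          fun ω => by ring
        simp_rw [harg] at hst
        linarith
    have hfin := ind N le_rfl
    rw [htN] at hfin
    obtain ⟨h1, h2⟩ := hdt N le_rfl
    rw [htN] at h1 h2
    have hG0 : ∀ x, Gop m (Real.toNNReal (κ b - κ b)) g x = g x := fun x => by
      simp only [sub_self, Real.toNNReal_zero, Gop, gaussianReal_zero_var, integral_dirac, Real.log_exp]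
      field_simp
    simp_rw [hG0] at hfin
    have i1 : Integrable (fun ω => g (X ω + m * I b ω + (W b ω - W a ω))) P :=
      lip_integrable hg ((hXi.add ((hIi _ hbI).const_mul m)).add (hWint _ hbI))
    have i2 : Integrable (fun ω => g (X ω + m * I (d N) ω + (W b ω - W a ω))) P :=
      lip_integrable hg ((hXi.add ((hIi _ (hdI N)).const_mul m)).add (hWint _ hbI))
    have c1 : ∫ ω, g (X ω + m * I b ω + (W b ω - W a ω)) ∂P
        ≤ ∫ ω, (g (X ω + m * I (d N) ω + (W b ω - W a ω)) + m * Δ) ∂P := by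
      refine integral_mono i1 (i2.add (integrable_const _)) fun ω => ?_
      have e1 := hg.dist_le_mul (X ω + m * I b ω + (W b ω - W a ω))
        (X ω + m * I (d N) ω + (W b ω - W a ω))
      rw [dist_add_right, dist_add_left, Real.dist_eq, Real.dist_eq, ← mul_sub, abs_mul,
        abs_of_pos hm] at e1
      have e2 := hIl _ (hdI N) _ hbI h1 ω
      have e3 : m * |I b ω - I (d N) ω| ≤ m * Δ := by gcongr; linarith
      have e4 := (abs_le.1 e1).2
      simp only [NNReal.coe_one, one_mul] at e4
      dsimp only
      linarith
    rw [integral_add i2 (integrable_const _)] at c1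
    simp only [integral_const, probReal_univ, one_smul] at c1
    have c2 : ∫ ω, J (d N) ω ∂P ≤ ∫ ω, J b ω ∂P :=
      integral_mono (hJi _ (hdI N)) (hJi _ hbI) fun ω => hJp _ (hdI N) _ hbI h1 ω
    have c3 : m / 2 * ∫ ω, J (d N) ω ∂P ≤ m / 2 * ∫ ω, J b ω ∂P := by gcongr
    have c4 : m * Δ = m * K * (1 / ((n : ℝ) + 1)) := by rw [hΔ, hNr]; ring
    linarith
  have hlim : Tendsto (fun n : ℕ => RHS + m * K * (1 / ((n : ℝ) + 1))) atTop (nhds RHS) := by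
    have := (tendsto_one_div_add_atTop_nhds_zero_nat (𝕜 := ℝ)).const_mul (m * K)
    simpa using this.const_add RHS
  exact ge_of_tendsto' hlim main

lemma prog_joint {Ω : Type*} [m : MeasurableSpace Ω] {w : ℝ → Ω → ℝ} {q : ℝ}
    (hw : StronglyMeasurable fun p : Set.Iic q × Ω => w p.1 p.2) :
    StronglyMeasurable (fun x : Ω × ℝ => w (min x.2 q) x.1) := by
  have : Measurable (fun x : Ω × ℝ => ((⟨min x.2 q, Set.mem_Iic.2 (min_le_right _ _)⟩ : Set.Iic q), x.1)) :=
    ((measurable_snd.min measurable_const).subtype_mk).prodMk measurable_fst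
  exact hw.comp_measurable this

lemma prog_sect {Ω : Type*} [m : MeasurableSpace Ω] {w : ℝ → Ω → ℝ} {q : ℝ}
    (hw : StronglyMeasurable fun p : Set.Iic q × Ω => w p.1 p.2) (ω : Ω) :
    Measurable (fun r => w (min r q) ω) :=
  (prog_joint hw).measurable.comp (measurable_const.prodMk measurable_id)

lemma prog_int {Ω : Type*} [m : MeasurableSpace Ω] {w : ℝ → Ω → ℝ} {p q : ℝ}
    (hw : StronglyMeasurable fun p : Set.Iic q × Ω => w p.1 p.2) {φ : ℝ → ℝ} (hφ : Measurable φ)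
    (hpq : p ≤ q) :
    Measurable (fun ω => ∫ r in p..q, φ r * w r ω) := by
  have h1 : (fun ω => ∫ r in p..q, φ r * w r ω)
      = fun ω => ∫ r in Ioc p q, φ r * w (min r q) ω := by
    funext ω
    rw [intervalIntegral.integral_of_le hpq]
    refine setIntegral_congr_fun measurableSet_Ioc fun r hr => ?_
    simp [min_eq_left hr.2]
  rw [h1]
  have h2 : StronglyMeasurable (fun x : Ω × ℝ => φ x.2 * w (min x.2 q) x.1) :=
    (hφ.comp measurable_snd).stronglyMeasurable.mul (prog_joint hw)
  exact h2.integral_prod_right'.measurable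

lemma ii_mul {φ f : ℝ → ℝ} {p q C : ℝ} (hφ : Measurable φ) (hφC : ∀ r, |φ r| ≤ C)
    (hf : Measurable (fun r => f (min r q))) (hf1 : ∀ r ∈ Icc p q, |f r| ≤ 1) (hpq : p ≤ q) :
    IntervalIntegrable (fun r => φ r * f r) volume p q := by
  rw [intervalIntegrable_iff_integrableOn_Ioc_of_le hpq]
  have h1 : IntegrableOn (fun r => φ r * f (min r q)) (Ioc p q) := by
    refine Measure.integrableOn_of_bounded (M := C) (by simp) (hφ.mul hf).aestronglyMeasurable ?_
    refine (ae_restrict_iff' measurableSet_Ioc).2 (Eventually.of_forall fun r hr => ?_)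
    rw [min_eq_left hr.2, Real.norm_eq_abs, abs_mul]
    have a1 := hφC r
    have a2 := hf1 r ⟨hr.1.le, hr.2⟩
    have a3 := abs_nonneg (φ r)
    nlinarith [abs_nonneg (f r)]
  refine h1.congr_fun (fun r hr => ?_) measurableSet_Ioc
  simp [min_eq_left hr.2]

lemma sect_facts {φ f : ℝ → ℝ} {p q C : ℝ} (hφ : Measurable φ) (hφC : ∀ r, |φ r| ≤ C)
    (hφ0 : ∀ r, 0 ≤ φ r)
    (hf : Measurable (fun r => f (min r q))) (hf1 : ∀ r ∈ Icc p q, |f r| ≤ 1) (hpq : p ≤ q) :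
    |∫ r in p..q, φ r * f r| ≤ ∫ r in p..q, φ r ∧ 0 ≤ ∫ r in p..q, φ r * f r ^ 2 ∧
    (∫ r in p..q, φ r * f r ^ 2) ≤ ∫ r in p..q, φ r ∧
    (∫ r in p..q, φ r * f r) ^ 2 ≤ (∫ r in p..q, φ r) * ∫ r in p..q, φ r * f r ^ 2 := by
  have i0 : IntervalIntegrable φ volume p q := by
    simpa using ii_mul (f := fun _ => 1) hφ hφC measurable_const (by simp) hpq
  have i1 := ii_mul hφ hφC hf hf1 hpq
  have i2 : IntervalIntegrable (fun r => φ r * f r ^ 2) volume p q :=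
    ii_mul (f := fun r => f r ^ 2) hφ hφC (hf.pow_const 2)
      (fun r hr => by rw [abs_pow]; exact pow_le_one₀ (abs_nonneg _) (hf1 r hr)) hpq
  have b2 : (∫ r in p..q, φ r * f r ^ 2) ≤ ∫ r in p..q, φ r := by
    refine intervalIntegral.integral_mono_on hpq i2 i0 fun r hr => ?_
    have : f r ^ 2 ≤ 1 := by rw [← sq_abs]; exact pow_le_one₀ (abs_nonneg _) (hf1 r hr)
    nlinarith [hφ0 r]
  have b1 : 0 ≤ ∫ r in p..q, φ r * f r ^ 2 :=
    intervalIntegral.integral_nonneg hpq fun r _ => mul_nonneg (hφ0 r) (sq_nonneg _)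
  refine ⟨?_, b1, b2, ?_⟩
  · rw [abs_le]
    constructor
    · rw [← intervalIntegral.integral_neg]
      refine intervalIntegral.integral_mono_on hpq i0.neg i1 fun r hr => ?_
      have := (abs_le.1 (hf1 r hr)).1
      nlinarith [hφ0 r]
    · refine intervalIntegral.integral_mono_on hpq i1 i0 fun r hr => ?_
      have := (abs_le.1 (hf1 r hr)).2
      nlinarith [hφ0 r]
  · have quad : ∀ l : ℝ, 0 ≤ (∫ r in p..q, φ r) * (l * l) + (-2 * ∫ r in p..q, φ r * f r) * l
        + ∫ r in p..q, φ r * f r ^ 2 := by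
      intro l
      have e : ∫ r in p..q, φ r * (f r - l) ^ 2 = (∫ r in p..q, φ r) * (l * l)
          + (-2 * ∫ r in p..q, φ r * f r) * l + ∫ r in p..q, φ r * f r ^ 2 := by
        have : ∀ r, φ r * (f r - l) ^ 2 = φ r * (l * l) + (φ r * f r) * (-2 * l) + φ r * f r ^ 2 :=
          fun r => by ring
        simp_rw [this]
        rw [intervalIntegral.integral_add ((i0.mul_const _).add (i1.mul_const _)) i2,
          intervalIntegral.integral_add (i0.mul_const _) (i1.mul_const _),
          intervalIntegral.integral_mul_const, intervalIntegral.integral_mul_const]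
        ring
      rw [← e]
      exact intervalIntegral.integral_nonneg hpq fun r _ => mul_nonneg (hφ0 r) (sq_nonneg _)
    have := discrim_le_zero quad
    unfold discrim at this
    nlinarith

lemma logcosh_lip : LipschitzWith 1 (fun x : ℝ => Real.log (Real.cosh x)) := by
  refine lipschitzWith_of_nnnorm_deriv_le (𝕜 := ℝ)
    (fun x => (Real.differentiable_cosh x).log (Real.cosh_pos x).ne') fun x => ?_
  rw [deriv.log (Real.differentiable_cosh x) (Real.cosh_pos x).ne', Real.deriv_cosh,
    ← NNReal.coe_le_coe, coe_nnnorm, Real.norm_eq_abs, NNReal.coe_one, abs_div,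
    abs_of_pos (Real.cosh_pos x), div_le_one (Real.cosh_pos x), abs_le]
  have h1 := Real.cosh_add_sinh x
  have h2 := Real.cosh_sub_sinh x
  have := Real.exp_pos x
  have := Real.exp_pos (-x)
  constructor <;> linarith

lemma gStep_eq {β : ℕ → ℝ} {Φ : ℝ → ℝ → ℝ} {m t s : ℝ} (x : ℝ) (hm : 0 < m)
    (hg : LipschitzWith 1 (Φ t)) (hv : xiD β s ≤ xiD β t) :
    gStep β Φ m t s x = Gop m (Real.toNNReal (xiD β t - xiD β s)) (Φ t) x := by
  unfold gStep Gop
  rw [if_neg hm.ne', gauss_integral_shift _ x]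
  have h := gaussianReal_map_mul_const (μ := 0) (v := 1) (Real.sqrt (xiD β t - xiD β s))
  have hv' : NNReal.mk (Real.sqrt (xiD β t - xiD β s) ^ 2) (sq_nonneg _) * 1
      = Real.toNNReal (xiD β t - xiD β s) := by
    ext
    simp [Real.sq_sqrt (sub_nonneg.2 hv), Real.coe_toNNReal _ (sub_nonneg.2 hv)]
  rw [hv', mul_zero] at h
  rw [← h, integral_map (by fun_prop)]
  have := hg.continuous
  exact (by fun_prop : Continuous fun z => Real.exp (m * Φ t (x + z))).aestronglyMeasurable

lemma nextPt_spec {μ : Measure ℝ} {S : Finset ℝ} (hS : ∀ q, μ {q} ≠ 0 → q ∈ S) {a : ℝ} (ha : a < 1) :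
    a < nextPt μ a ∧ nextPt μ a ≤ 1 ∧ (nextPt μ a = 1 ∨ μ {nextPt μ a} ≠ 0) ∧
    ∀ q, a < q → q ≤ 1 → μ {q} ≠ 0 → nextPt μ a ≤ q := by
  set T : Set ℝ := {q : ℝ | a < q ∧ q ≤ 1 ∧ μ {q} ≠ 0} ∪ {1} with hT
  have hfin : T.Finite := by
    refine Set.Finite.union (S.finite_toSet.subset fun q hq => hS q hq.2.2) (finite_singleton _)
  have hne : T.Nonempty := ⟨1, Or.inr rfl⟩
  have hmem : nextPt μ a ∈ T := hne.csInf_mem hfin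
  have hle : ∀ q ∈ T, nextPt μ a ≤ q := fun q hq => csInf_le hfin.bddBelow hq
  refine ⟨?_, hle 1 (Or.inr rfl), ?_, fun q h1 h2 h3 => hle q (Or.inl ⟨h1, h2, h3⟩)⟩
  · rcases hmem with h | h
    · exact h.1
    · rw [mem_singleton_iff.1 h]; exact ha
  · rcases hmem with h | h
    · exact Or.inr h.2.2
    · exact Or.inl h

lemma distF_const {μ : Measure ℝ} [IsProbabilityMeasure μ] {S : Finset ℝ} (hS : μ (S : Set ℝ)ᶜ = 0)
    {a r : ℝ} (ha : 0 ≤ a) (har : a ≤ r) (hno : ∀ q, a < q → q ≤ r → μ {q} = 0) :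
    distF μ r = distF μ a := by
  have h0 : μ (Ioc a r) = 0 := by
    have h1 : Ioc a r ⊆ (S : Set ℝ)ᶜ ∪ ⋃ q ∈ S.filter (fun q => a < q ∧ q ≤ r), {q} := by
      intro q hq
      by_cases hqS : q ∈ S
      · right; simp [hqS, hq.1, hq.2]
      · left; simpa using hqS
    refine measure_mono_null h1 (measure_union_null hS ?_)
    refine (measure_biUnion_null_iff (I := {q | q ∈ S.filter (fun q => a < q ∧ q ≤ r)})
      (Finset.countable_toSet _)).2 ?_
    intro q hq
    simp at hq
    exact hno q hq.2.1 hq.2.2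
  unfold distF
  congr 1
  refine le_antisymm ?_ (measure_mono (Icc_subset_Icc_right har))
  rw [← Icc_union_Ioc_eq_Icc ha har]
  exact (measure_union_le _ _).trans (by rw [h0, add_zero])

lemma distF_mono (μ : Measure ℝ) [IsProbabilityMeasure μ] : Monotone (distF μ) := fun _ _ h =>
  ENNReal.toReal_mono (measure_ne_top _ _) (measure_mono (Icc_subset_Icc_right h))

lemma distF_le_one (μ : Measure ℝ) [IsProbabilityMeasure μ] (r : ℝ) : distF μ r ≤ 1 := by
  have := ENNReal.toReal_mono (b := 1) (by simp) (prob_le_one (μ := μ) (s := Icc 0 r))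
  simpa [distF] using this

/-- **Lemma 3 of the paper.** For finitely supported `μ ∈ 𝓜_d` and two support
points `s < t` of `μ`, every `u ∈ 𝓓[s,t]` satisfies `Φ_μ(s,x) ≥ F^{s,t}(u,x)`. -/
theorem stmt9 {Ω : Type*} [mΩ : MeasurableSpace Ω] (P : Measure Ω) [IsProbabilityMeasure P]
    (β : ℕ → ℝ) (hβ : ValidBeta β)
    (Φ : Measure ℝ → ℝ → ℝ → ℝ) (hΦ : IsParisiFamily β Φ)
    (B : ℝ → Ω → ℝ) (hB : IsStdBM P B)
    (𝓕 : Filtration ℝ mΩ)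
    (h𝓕 : ∀ r : ℝ, (𝓕 r : MeasurableSpace Ω)
      = ⨆ v ∈ Icc (0 : ℝ) r, MeasurableSpace.comap (fun ω => B (xiD β v) ω) inferInstance)
    (μ : Measure ℝ) (hμ : MemM μ) (hfs : FinSupp μ)
    (s t : ℝ) (hst : s < t) (hsAtom : μ {s} ≠ 0) (htAtom : μ {t} ≠ 0)
    (x : ℝ) (u : ℝ → Ω → ℝ) (hu : InD 𝓕 s t u) :
    Ffn P β μ (Φ μ) (fun r => B (xiD β r)) s t u x ≤ Φ μ s x := by
  classical
  obtain ⟨hprob, hcompl⟩ := id hμ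
  obtain ⟨S, hS⟩ := id hfs
  obtain ⟨hu1, hu2⟩ := hu
  have hprog : IsStronglyProgressive 𝓕 u := hu1
  have hprog2 : IsStronglyProgressive 𝓕 (fun r ω => u r ω ^ 2) := by
    intro i
    exact (hu1 i).pow 2
  obtain ⟨hBm, _, _, hBl, hBi⟩ := hB
  obtain ⟨hΦ1, hΦr⟩ := hΦ.1 μ hμ hfs
  -- atoms
  have hAS : ∀ q, μ {q} ≠ 0 → q ∈ S := fun q hq => by
    by_contra hcon
    exact hq (measure_mono_null (by simpa using hcon) hS)
  have hA01 : ∀ q, μ {q} ≠ 0 → q ∈ Icc (0 : ℝ) 1 := fun q hq => by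
    by_contra hcon
    exact hq (measure_mono_null (by simpa using hcon) hcompl)
  have hs01 := hA01 s hsAtom
  have ht01 := hA01 t htAtom
  have hmpos : ∀ r, s ≤ r → 0 < distF μ r := fun r hr => by
    refine ENNReal.toReal_pos ?_ (measure_ne_top _ _)
    intro h0
    exact hsAtom (measure_mono_null (singleton_subset_iff.2 (show s ∈ Icc (0 : ℝ) r from ⟨hs01.1, hr⟩)) h0)
  have hκ := xiD_strictMonoOn hβ
  -- Lipschitz
  have hrec : ∀ a, s ≤ a → a < 1 → LipschitzWith 1 (Φ μ (nextPt μ a)) → ∀ y,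
      Φ μ a y = Gop (distF μ a) (Real.toNNReal (xiD β (nextPt μ a) - xiD β a)) (Φ μ (nextPt μ a)) y := by
    intro a hsa ha1 hL y
    obtain ⟨h1, h2, _, _⟩ := nextPt_spec hAS ha1
    rw [hΦr a ⟨hs01.1.trans hsa, ha1⟩ y]
    exact gStep_eq y (hmpos a hsa) hL (hκ.monotoneOn ⟨hs01.1.trans hsa, ha1.le⟩
      ⟨(hs01.1.trans hsa).trans h1.le, h2⟩ h1.le)
  have hlip1 : LipschitzWith 1 (Φ μ 1) := by
    have : Φ μ 1 = fun x => Real.log (Real.cosh x) := funext hΦ1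
    rw [this]; exact logcosh_lip
  have hlip : ∀ n : ℕ, ∀ a, (S.filter (fun q => a < q)).card = n → s ≤ a → μ {a} ≠ 0 →
      LipschitzWith 1 (Φ μ a) := by
    intro n
    induction n using Nat.strong_induction_on with
    | _ n ih =>
      intro a hcard hsa haA
      rcases (hA01 a haA).2.eq_or_lt with rfl | ha1
      · exact hlip1
      · obtain ⟨h1, h2, h3, h4⟩ := nextPt_spec hAS ha1
        have hLn : LipschitzWith 1 (Φ μ (nextPt μ a)) := by
          rcases h3 with h3 | h3
          · rw [h3]; exact hlip1
          · refine ih _ ?_ (nextPt μ a) rfl (hsa.trans h1.le) h3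
            rw [← hcard]
            refine Finset.card_lt_card (Finset.ssubset_iff_of_subset ?_ |>.2 ⟨nextPt μ a, ?_, ?_⟩)
            · intro q hq
              simp only [Finset.mem_filter] at hq ⊢
              exact ⟨hq.1, h1.trans hq.2⟩
            · simp [hAS _ h3, h1]
            · simp
        have : Φ μ a = Gop (distF μ a) (Real.toNNReal (xiD β (nextPt μ a) - xiD β a))
            (Φ μ (nextPt μ a)) := funext (hrec a hsa ha1 hLn)
        rw [this]
        exact Gop_lip hLn (hmpos a hsa) _
  have hlipA : ∀ a, s ≤ a → μ {a} ≠ 0 → LipschitzWith 1 (Φ μ a) := fun a h1 h2 => hlip _ a rfl h1 h2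
  -- Brownian facts
  set W : ℝ → Ω → ℝ := fun r => B (xiD β r) with hW
  have hWm : ∀ r ∈ Icc (0 : ℝ) 1, Measurable[𝓕 r] (W r) := fun r hr => by
    rw [h𝓕 r]
    have h1 : MeasurableSpace.comap (W r) inferInstance ≤
        ⨆ v ∈ Icc (0 : ℝ) r, MeasurableSpace.comap (fun ω => B (xiD β v) ω) inferInstance :=
      le_iSup₂_of_le (f := fun v (_ : v ∈ Icc (0 : ℝ) r) =>
        MeasurableSpace.comap (fun ω => B (xiD β v) ω) inferInstance) r ⟨hr.1, le_rfl⟩ le_rfl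
    exact (comap_measurable (W r)).mono h1 le_rfl
  have hWl : ∀ p ∈ Icc (0 : ℝ) 1, ∀ q ∈ Icc (0 : ℝ) 1, p ≤ q →
      P.map (fun ω => W q ω - W p ω) = gaussianReal 0 (Real.toNNReal (xiD β q - xiD β p)) :=
    fun p hp q hq hpq => hBl _ _ (xiD_nonneg hp) (hκ.monotoneOn hp hq hpq)
  have hWi : ∀ p ∈ Icc (0 : ℝ) 1, ∀ q ∈ Icc (0 : ℝ) 1, p ≤ q →
      Indep (MeasurableSpace.comap (fun ω => W q ω - W p ω) inferInstance) (𝓕 p) P := by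
    intro p hp q hq hpq
    refine indep_of_indep_of_le_right
      (hBi _ _ (xiD_nonneg hp) (hκ.monotoneOn hp hq hpq)) ?_
    rw [h𝓕 p]
    refine iSup₂_le fun v hv => ?_
    have hv1 : v ∈ Icc (0 : ℝ) 1 := ⟨hv.1, hv.2.trans hp.2⟩
    exact le_iSup₂_of_le (f := fun v (_ : v ∈ Icc (0 : ℝ) (xiD β p)) =>
        MeasurableSpace.comap (B v) inferInstance) (xiD β v)
      ⟨xiD_nonneg hv1, hκ.monotoneOn hv1 hp hv.2⟩ le_rfl
  -- the truncated weight
  set zt : ℝ → ℝ := (Icc (0 : ℝ) 1).indicator (zetaFn β) with hzt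
  have hztm : Measurable zt := by
    rw [hzt, ← Set.piecewise_eq_indicator]
    exact ContinuousOn.measurable_piecewise (zeta_contOn hβ) continuousOn_const measurableSet_Icc
  have hzt0 : ∀ r, 0 ≤ zt r := fun r => Set.indicator_nonneg (fun r hr => zeta_nonneg hr) r
  obtain ⟨C, hC⟩ : ∃ C, ∀ r, |zt r| ≤ C := by
    obtain ⟨C, hC⟩ := isCompact_Icc.exists_bound_of_continuousOn (zeta_contOn hβ)
    refine ⟨max C 0, fun r => ?_⟩
    by_cases hr : r ∈ Icc (0 : ℝ) 1
    · rw [hzt, Set.indicator_of_mem hr]; exact (hC r hr).trans (le_max_left _ _)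
    · rw [hzt, Set.indicator_of_notMem hr]; simp
  have hC0 : 0 ≤ C := (abs_nonneg _).trans (hC 0)
  have hzti : ∀ p ∈ Icc (0 : ℝ) 1, ∀ q ∈ Icc (0 : ℝ) 1, p ≤ q →
      ∫ r in p..q, zt r = xiD β q - xiD β p := by
    intro p hp q hq hpq
    rw [← integral_zeta hβ hp.1 hpq hq.2]
    refine intervalIntegral.integral_congr fun r hr => ?_
    rw [uIcc_of_le hpq] at hr
    have hr' : r ∈ Icc (0 : ℝ) 1 := ⟨hp.1.trans hr.1, hr.2.trans hq.2⟩
    simp only [hzt, Set.indicator_of_mem hr']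
  set A : ℝ → ℝ := fun r => distF μ r * zt r with hA
  have hAm : Measurable A := (distF_mono μ).measurable.mul hztm
  have hd0 : ∀ r, 0 ≤ distF μ r := fun r => ENNReal.toReal_nonneg
  have hAC : ∀ r, |A r| ≤ C := fun r => by
    simp only [hA]
    rw [abs_mul, abs_of_nonneg (hd0 r)]
    calc distF μ r * |zt r| ≤ 1 * C :=
          mul_le_mul (distF_le_one μ r) (hC r) (abs_nonneg _) zero_le_one
      _ = C := one_mul C
  have hA0 : ∀ r, 0 ≤ A r := fun r => mul_nonneg (hd0 r) (hzt0 r)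
  have hsub01 : ∀ r ∈ Icc s t, r ∈ Icc (0 : ℝ) 1 := fun r hr => ⟨hs01.1.trans hr.1, hr.2.trans ht01.2⟩
  have husq : ∀ r ∈ Icc s t, ∀ ω, |u r ω ^ 2| ≤ 1 := fun r hr ω => by
    rw [abs_pow]; exact pow_le_one₀ (abs_nonneg _) (hu2 r hr ω)
  have hii : ∀ φ : ℝ → ℝ, Measurable φ → (∀ r, |φ r| ≤ C) → ∀ p ∈ Icc s t, ∀ q ∈ Icc s t, p ≤ q →
      ∀ ω, IntervalIntegrable (fun r => φ r * u r ω) volume p q := fun φ h1 h2 p hp q hq hpq ω =>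
    ii_mul (f := fun r => u r ω) h1 h2 (prog_sect (m := 𝓕 q) (hprog q) ω)
      (fun r hr => hu2 r ⟨hp.1.trans hr.1, hr.2.trans hq.2⟩ ω) hpq
  have hii2 : ∀ φ : ℝ → ℝ, Measurable φ → (∀ r, |φ r| ≤ C) → ∀ p ∈ Icc s t, ∀ q ∈ Icc s t, p ≤ q →
      ∀ ω, IntervalIntegrable (fun r => φ r * u r ω ^ 2) volume p q := fun φ h1 h2 p hp q hq hpq ω =>
    ii_mul (f := fun r => u r ω ^ 2) h1 h2 (prog_sect (m := 𝓕 q) (w := fun r ω => u r ω ^ 2) (hprog2 q) ω)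
      (fun r hr => husq r ⟨hp.1.trans hr.1, hr.2.trans hq.2⟩ ω) hpq
  have hsf : ∀ φ : ℝ → ℝ, Measurable φ → (∀ r, |φ r| ≤ C) → (∀ r, 0 ≤ φ r) →
      ∀ p ∈ Icc s t, ∀ q ∈ Icc s t, p ≤ q → ∀ ω,
      |∫ r in p..q, φ r * u r ω| ≤ ∫ r in p..q, φ r ∧ 0 ≤ ∫ r in p..q, φ r * u r ω ^ 2 ∧
      (∫ r in p..q, φ r * u r ω ^ 2) ≤ ∫ r in p..q, φ r ∧
      (∫ r in p..q, φ r * u r ω) ^ 2 ≤ (∫ r in p..q, φ r) * ∫ r in p..q, φ r * u r ω ^ 2 :=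
    fun φ h1 h2 h3 p hp q hq hpq ω =>
    sect_facts (f := fun r => u r ω) h1 h2 h3 (prog_sect (m := 𝓕 q) (hprog q) ω)
      (fun r hr => hu2 r ⟨hp.1.trans hr.1, hr.2.trans hq.2⟩ ω) hpq
  have hmeas : ∀ φ : ℝ → ℝ, Measurable φ → ∀ p q, p ≤ q →
      Measurable[𝓕 q] (fun ω => ∫ r in p..q, φ r * u r ω) := fun φ h1 p q hpq =>
    prog_int (m := 𝓕 q) (hprog q) h1 hpq
  have hmeas2 : ∀ φ : ℝ → ℝ, Measurable φ → ∀ p q, p ≤ q →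
      Measurable[𝓕 q] (fun ω => ∫ r in p..q, φ r * u r ω ^ 2) := fun φ h1 p q hpq =>
    prog_int (m := 𝓕 q) (w := fun r ω => u r ω ^ 2) (hprog2 q) h1 hpq
  have hAi : ∀ p ∈ Icc s t, ∀ q ∈ Icc s t, p ≤ q →
      Integrable (fun ω => ∫ r in p..q, A r * u r ω) P := fun p hp q hq hpq =>
    Integrable.of_bound (((hmeas A hAm p q hpq).mono (𝓕.le q) le_rfl).aestronglyMeasurable)
      (∫ r in p..q, A r) (Eventually.of_forall fun ω => (hsf A hAm hAC hA0 p hp q hq hpq ω).1)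
  have hAi2 : ∀ p ∈ Icc s t, ∀ q ∈ Icc s t, p ≤ q →
      Integrable (fun ω => ∫ r in p..q, A r * u r ω ^ 2) P := fun p hp q hq hpq =>
    Integrable.of_bound (((hmeas2 A hAm p q hpq).mono (𝓕.le q) le_rfl).aestronglyMeasurable)
      (∫ r in p..q, A r) (Eventually.of_forall fun ω => by
        obtain ⟨_, h2, h3, _⟩ := hsf A hAm hAC hA0 p hp q hq hpq ω
        rw [Real.norm_eq_abs, abs_of_nonneg h2]; exact h3)
  have hWint : ∀ p ∈ Icc (0 : ℝ) 1, ∀ q ∈ Icc (0 : ℝ) 1, p ≤ q →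
      Integrable (fun ω => W q ω - W p ω) P := fun p hp q hq hpq => by
    have := gauss_id_integrable 0 (Real.toNNReal (xiD β q - xiD β p))
    rw [← hWl p hp q hq hpq] at this
    exact (integrable_map_measure (g := fun z : ℝ => z)
      continuous_id.aestronglyMeasurable ((hBm _).sub (hBm _)).aemeasurable).1 this
  -- main induction over the atoms
  have main : ∀ n : ℕ, ∀ a, (S.filter (fun q => a < q)).card = n → a ∈ Icc s t → μ {a} ≠ 0 →
      ∀ X : Ω → ℝ, Measurable[𝓕 a] X → Integrable X P →
      (∫ ω, Φ μ t (X ω + (∫ r in a..t, A r * u r ω) + (W t ω - W a ω)) ∂P)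
        - 1 / 2 * ∫ ω, (∫ r in a..t, A r * u r ω ^ 2) ∂P ≤ ∫ ω, Φ μ a (X ω) ∂P := by
    intro n
    induction n using Nat.strong_induction_on with
    | _ n ih =>
      intro a hcard haI haA X hX hXi
      rcases haI.2.eq_or_lt with rfl | hat
      · simp
      have ha1 : a < 1 := hat.trans_le ht01.2
      obtain ⟨h1, h2, h3, h4⟩ := nextPt_spec hAS ha1
      have hbt : nextPt μ a ≤ t := h4 t hat ht01.2 htAtom
      have hbA : μ {nextPt μ a} ≠ 0 := by
        rcases h3 with h3 | h3
        · have : nextPt μ a = t := le_antisymm hbt (by rw [h3]; exact ht01.2)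
          rw [this]; exact htAtom
        · exact h3
      have hnoatom : ∀ q, a < q → q < nextPt μ a → μ {q} = 0 := fun q hq1 hq2 => by
        by_contra hcon
        exact absurd (h4 q hq1 (hq2.le.trans h2) hcon) (not_le.2 hq2)
      have hrec' := hrec a haI.1 ha1
      set b := nextPt μ a with hb
      have hbI : b ∈ Icc s t := ⟨haI.1.trans h1.le, hbt⟩
      have htI : t ∈ Icc s t := ⟨hst.le, le_rfl⟩
      have hLb := hlipA b hbI.1 hbA
      have hsubab : ∀ r ∈ Icc a b, r ∈ Icc s t := fun r hr => ⟨haI.1.trans hr.1, hr.2.trans hbt⟩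
      have hsub1 : ∀ r ∈ Icc a b, r ∈ Icc (0 : ℝ) 1 := fun r hr => hsub01 r (hsubab r hr)
      set m := distF μ a with hm
      have hmp : 0 < m := hmpos a haI.1
      have hmA : ∀ f : ℝ → ℝ, ∫ r in a..b, A r * f r = m * ∫ r in a..b, zt r * f r := by
        intro f
        rw [← intervalIntegral.integral_const_mul]
        refine intervalIntegral.integral_congr_ae ?_
        have hae : ∀ᵐ r : ℝ, r ≠ b := by simp [ae_iff]
        filter_upwards [hae] with r hrb hr
        rw [uIoc_of_le h1.le] at hr
        have : distF μ r = m := distF_const hS (hs01.1.trans haI.1) hr.1.le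
          fun q hq1 hq2 => hnoatom q hq1 (hq2.trans_lt (lt_of_le_of_ne hr.2 hrb))
        simp only [hA, this]; ring
      have hIadd : ∀ p ∈ Icc a b, ∀ q ∈ Icc a b, p ≤ q → ∀ ω,
          (∫ r in a..q, zt r * u r ω) - ∫ r in a..p, zt r * u r ω = ∫ r in p..q, zt r * u r ω :=
        fun p hp q hq hpq ω => intervalIntegral.integral_interval_sub_left
          (hii zt hztm hC a haI q (hsubab q hq) hq.1 ω) (hii zt hztm hC a haI p (hsubab p hp) hp.1 ω)
      have hJadd : ∀ p ∈ Icc a b, ∀ q ∈ Icc a b, p ≤ q → ∀ ω,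
          (∫ r in a..q, zt r * u r ω ^ 2) - ∫ r in a..p, zt r * u r ω ^ 2
            = ∫ r in p..q, zt r * u r ω ^ 2 :=
        fun p hp q hq hpq ω => intervalIntegral.integral_interval_sub_left
          (hii2 zt hztm hC a haI q (hsubab q hq) hq.1 ω)
          (hii2 zt hztm hC a haI p (hsubab p hp) hp.1 ω)
      have hfin0 := interval_abs (P := P) (𝓕 := 𝓕) (κ := xiD β) h1
        ((xiD_contOn hβ).mono hsub1) (hκ.mono hsub1) (W := W)
        (fun r hr => hWm r (hsub1 r hr))
        (fun p hp q hq hpq => hWl p (hsub1 p hp) q (hsub1 q hq) hpq)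
        (fun p hp q hq hpq => hWi p (hsub1 p hp) q (hsub1 q hq) hpq)
        (I := fun q ω => ∫ r in a..q, zt r * u r ω)
        (J := fun q ω => ∫ r in a..q, zt r * u r ω ^ 2)
        (fun ω => by simp) (fun ω => by simp)
        (fun r hr => hmeas zt hztm a r hr.1) (fun r hr => hmeas2 zt hztm a r hr.1)
        (fun p hp q hq hpq ω => by
          rw [hIadd p hp q hq hpq ω, ← hzti p (hsub1 p hp) q (hsub1 q hq) hpq]
          exact (hsf zt hztm hC hzt0 p (hsubab p hp) q (hsubab q hq) hpq ω).1)
        (fun p hp q hq hpq ω => by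
          rw [hJadd p hp q hq hpq ω, ← hzti p (hsub1 p hp) q (hsub1 q hq) hpq]
          obtain ⟨_, k2, k3, _⟩ := hsf zt hztm hC hzt0 p (hsubab p hp) q (hsubab q hq) hpq ω
          rw [abs_of_nonneg k2]; exact k3)
        (fun p hp q hq hpq ω => by
          have k1 := hJadd p hp q hq hpq ω
          have k2 := (hsf zt hztm hC hzt0 p (hsubab p hp) q (hsubab q hq) hpq ω).2.1
          linarith)
        (fun p hp q hq hpq ω => by
          rw [hIadd p hp q hq hpq ω, hJadd p hp q hq hpq ω,
            ← hzti p (hsub1 p hp) q (hsub1 q hq) hpq]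
          exact (hsf zt hztm hC hzt0 p (hsubab p hp) q (hsubab q hq) hpq ω).2.2.2)
        hLb hmp hX hXi
      simp_rw [← hrec' hLb, ← hmA] at hfin0
      have hJm : m / 2 * ∫ ω, (∫ r in a..b, zt r * u r ω ^ 2) ∂P
          = 1 / 2 * ∫ ω, (∫ r in a..b, A r * u r ω ^ 2) ∂P := by
        simp_rw [hmA]
        rw [integral_const_mul]; ring
      rw [hJm] at hfin0
      have hcard' : (S.filter (fun q => b < q)).card < n := by
        rw [← hcard]
        refine Finset.card_lt_card (Finset.ssubset_iff_of_subset ?_ |>.2 ⟨b, ?_, ?_⟩)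
        · intro q hq
          simp only [Finset.mem_filter] at hq ⊢
          exact ⟨hq.1, h1.trans hq.2⟩
        · simp [hAS _ hbA, h1]
        · simp
      have hnext := ih _ hcard' b rfl hbI hbA
        (fun ω => X ω + (∫ r in a..b, A r * u r ω) + (W b ω - W a ω))
        (((hX.mono (𝓕.mono h1.le) le_rfl).add (hmeas A hAm a b h1.le)).add
          ((hWm b (hsub01 b hbI)).sub ((hWm a (hsub01 a haI)).mono (𝓕.mono h1.le) le_rfl)))
        ((hXi.add (hAi a haI b hbI h1.le)).add (hWint a (hsub01 a haI) b (hsub01 b hbI) h1.le))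
      have hsplit : ∀ ω, X ω + (∫ r in a..b, A r * u r ω) + (W b ω - W a ω)
          + (∫ r in b..t, A r * u r ω) + (W t ω - W b ω)
          = X ω + (∫ r in a..t, A r * u r ω) + (W t ω - W a ω) := fun ω => by
        rw [← intervalIntegral.integral_add_adjacent_intervals
          (hii A hAm hAC a haI b hbI h1.le ω) (hii A hAm hAC b hbI t htI hbt ω)]
        ring
      have hsplit2 : ∫ ω, (∫ r in a..t, A r * u r ω ^ 2) ∂P
          = ∫ ω, (∫ r in a..b, A r * u r ω ^ 2) ∂P + ∫ ω, (∫ r in b..t, A r * u r ω ^ 2) ∂P := by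
        rw [← integral_add (hAi2 a haI b hbI h1.le) (hAi2 b hbI t htI hbt)]
        refine integral_congr_ae (Eventually.of_forall fun ω => ?_)
        exact (intervalIntegral.integral_add_adjacent_intervals
          (hii2 A hAm hAC a haI b hbI h1.le ω) (hii2 A hAm hAC b hbI t htI hbt ω)).symm
      simp_rw [hsplit] at hnext
      rw [hsplit2]
      linarith
  have hsI : s ∈ Icc s t := ⟨le_rfl, hst.le⟩
  have htI : t ∈ Icc s t := ⟨hst.le, le_rfl⟩
  have hfin := main _ s rfl hsI hsAtom (fun _ => x) measurable_const (integrable_const x)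
  have hcongr : ∀ f : ℝ → ℝ, ∫ r in s..t, distF μ r * zetaFn β r * f r = ∫ r in s..t, A r * f r := by
    intro f
    refine intervalIntegral.integral_congr fun r hr => ?_
    rw [uIcc_of_le hst.le] at hr
    simp only [hA, hzt, Set.indicator_of_mem (hsub01 r hr)]
  unfold Ffn
  have hc1 : ∀ ω, ∫ r in s..t, distF μ r * zetaFn β r * u r ω = ∫ r in s..t, A r * u r ω :=
    fun ω => hcongr fun r => u r ω
  have hc2 : ∀ ω, ∫ r in s..t, distF μ r * zetaFn β r * u r ω ^ 2 = ∫ r in s..t, A r * u r ω ^ 2 :=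
    fun ω => hcongr fun r => u r ω ^ 2
  simp_rw [hc1, hc2]
  have j1 : Integrable (fun ω => Φ μ t (x + (∫ r in s..t, A r * u r ω) + (W t ω - W s ω))) P :=
    lip_integrable (hlipA t hst.le htAtom) (((integrable_const x).add (hAi s hsI t htI hst.le)).add
      (hWint s hs01 t ht01 hst.le))
  rw [integral_sub j1 ((hAi2 s hsI t htI hst.le).const_mul _), integral_const_mul]
  simpa using hfin

end
end

section
/- For every μ ∈ 𝓜: (a) for each 0 ≤ j ≤ 4 the partial derivative ∂_x^j Φ_μ exists and is continuous on [0,1]×ℝ; (b) |∂_x Φ_μ(s,x)| ≤ 1 for all (s,x) ∈ [0,1]×ℝ; (c) there exists a constant C > 0, depending only on ξ, such that C/cosh²(x) ≤ ∂_{xx} Φ_μ(s,x) ≤ 1 for all (s,x) ∈ [0,1]×ℝ; and (d) |∂_x^3 Φ_μ(s,x)| ≤ 4 for all (s,x) ∈ [0,1]×ℝ. -/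
open MeasureTheory ProbabilityTheory Real Set Filter

noncomputable section

/-- a chain of successive derivatives up to order five -/
def Chain (f : ℕ → ℝ → ℝ) : Prop := ∀ j < 5, ∀ x, HasDerivAt (f j) (f (j + 1) x) x

/-- the quotients `(e^{mf})^{(j)} / (m e^{mf})` -/
def G3 (m : ℝ) (f : ℕ → ℝ → ℝ) (x : ℝ) : ℝ := f 3 x + 3 * m * f 1 x * f 2 x + m ^ 2 * f 1 x ^ 3
def G4 (m : ℝ) (f : ℕ → ℝ → ℝ) (x : ℝ) : ℝ :=
  f 4 x + 4 * m * f 1 x * f 3 x + 3 * m * f 2 x ^ 2 + 6 * m ^ 2 * f 1 x ^ 2 * f 2 x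
    + m ^ 3 * f 1 x ^ 4
def G5 (m : ℝ) (f : ℕ → ℝ → ℝ) (x : ℝ) : ℝ :=
  f 5 x + 5 * m * f 1 x * f 4 x + 10 * m * f 2 x * f 3 x + 10 * m ^ 2 * f 1 x ^ 2 * f 3 x
    + 15 * m ^ 2 * f 1 x * f 2 x ^ 2 + 10 * m ^ 3 * f 1 x ^ 3 * f 2 x + m ^ 4 * f 1 x ^ 5

structure Good (m c : ℝ) (f : ℕ → ℝ → ℝ) : Prop where
  der : Chain f
  b1 : ∀ x, |f 1 x| ≤ 1
  low : ∀ x, c / Real.cosh x ^ 2 ≤ f 2 x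
  b2 : ∀ x, f 2 x + m * f 1 x ^ 2 ≤ 1
  b3 : ∀ x, |G3 m f x| ≤ 4 - 3 * m
  b4 : ∀ x, |G4 m f x| ≤ 40 - 39 * m
  b5 : ∀ x, |G5 m f x| ≤ 1000 - 999 * m

lemma abs_le_lin {a b : ℝ} (h : ∀ e : ℝ, |e| = 1 → e * a ≤ b) : |a| ≤ b := by
  refine abs_le.2 ⟨?_, ?_⟩
  · have := h (-1) (by norm_num); linarith
  · have := h 1 (by norm_num); linarith

lemma abs_add_le' {a b A B : ℝ} (ha : |a| ≤ A) (hb : |b| ≤ B) : |a + b| ≤ A + B :=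
  (abs_add_le a b).trans (add_le_add ha hb)

lemma abs_mul_le' {a b A B : ℝ} (ha : |a| ≤ A) (hb : |b| ≤ B) : |a * b| ≤ A * B := by
  rw [abs_mul]; exact mul_le_mul ha hb (abs_nonneg _) ((abs_nonneg _).trans ha)

lemma Good.f2_nonneg {m c : ℝ} {f : ℕ → ℝ → ℝ} (h : Good m c f) (hc : 0 ≤ c) (x : ℝ) :
    0 ≤ f 2 x := (by positivity : 0 ≤ c / Real.cosh x ^ 2).trans (h.low x)

lemma Good.f2_le {m c : ℝ} {f : ℕ → ℝ → ℝ} (h : Good m c f) (hm : 0 < m) (x : ℝ) :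
    f 2 x ≤ 1 := by
  have := h.b2 x
  have : 0 ≤ m * f 1 x ^ 2 := by positivity
  linarith

lemma Good.f2_abs {m c : ℝ} {f : ℕ → ℝ → ℝ} (h : Good m c f) (hc : 0 ≤ c) (hm : 0 < m) (x : ℝ) :
    |f 2 x| ≤ 1 := abs_le.2 ⟨by linarith [h.f2_nonneg hc x], h.f2_le hm x⟩

lemma f12 {m p q : ℝ} (hm : 0 < m) (hp : |p| ≤ 1) (hq : 0 ≤ q) (h2 : q + m * p ^ 2 ≤ 1) :
    |p * q| ≤ |p| * (1 - m * p ^ 2) := by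
  rw [abs_mul, abs_of_nonneg hq]
  exact mul_le_mul_of_nonneg_left (by linarith) (abs_nonneg _)

lemma Good.f3 {m c : ℝ} {f : ℕ → ℝ → ℝ} (h : Good m c f) (hc : 0 ≤ c) (hm : 0 < m) (hm1 : m ≤ 1)
    (x : ℝ) : |f 3 x| ≤ 4 := by
  have h1 := h.b1 x
  have h2 := h.b2 x
  have h20 := h.f2_nonneg hc x
  have h3 := h.b3 x
  have h12 := f12 hm h1 h20 h2
  unfold G3 at h3
  set p := f 1 x
  set q := f 2 x
  have e : f 3 x = (f 3 x + 3 * m * p * q + m ^ 2 * p ^ 3) + (-(3 * m) * (p * q) + -(m ^ 2 * p ^ 3)) := by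
    ring
  have a0 := abs_nonneg p
  have k1 : |(-(3 * m) * (p * q))| ≤ 3 * m * (|p| * (1 - m * p ^ 2)) := by
    rw [abs_mul, abs_neg, abs_of_pos (by positivity : 0 < 3 * m)]
    exact mul_le_mul_of_nonneg_left h12 (by positivity)
  have k2 : |-(m ^ 2 * p ^ 3)| = m ^ 2 * (|p| * p ^ 2) := by
    rw [abs_neg, abs_mul, abs_of_pos (by positivity : 0 < m ^ 2), abs_pow]
    rw [← sq_abs p]; ring
  rw [e]
  refine (abs_add_le' h3 (abs_add_le' k1 k2.le)).trans ?_
  have : 0 ≤ m ^ 2 * (|p| * p ^ 2) := by positivity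
  nlinarith

lemma Good.f4 {m c : ℝ} {f : ℕ → ℝ → ℝ} (h : Good m c f) (hc : 0 ≤ c) (hm : 0 < m) (hm1 : m ≤ 1)
    (x : ℝ) : |f 4 x| ≤ 66 := by
  have h1 := h.b1 x
  have h2 := h.f2_abs hc hm x
  have h3 := h.f3 hc hm hm1 x
  have h4 := h.b4 x
  unfold G4 at h4
  have m1 : |m| ≤ 1 := by rw [abs_of_pos hm]; exact hm1
  have n : ∀ r : ℝ, |r| ≤ |r| := fun r => le_rfl
  have t1 := abs_mul_le' (abs_mul_le' (abs_mul_le' (n (-4)) m1) h1) h3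
  have t2 := abs_mul_le' (abs_mul_le' (n (-3)) m1) (abs_mul_le' h2 h2)
  have t3 := abs_mul_le' (abs_mul_le' (abs_mul_le' (n (-6)) (abs_mul_le' m1 m1))
    (abs_mul_le' h1 h1)) h2
  have t4 := abs_mul_le' (abs_mul_le' (abs_mul_le' m1 m1) (abs_mul_le' (n (-1)) m1))
    (abs_mul_le' (abs_mul_le' h1 h1) (abs_mul_le' h1 h1))
  have t := abs_add_le' (abs_add_le' (abs_add_le' (abs_add_le' h4 t1) t2) t3) t4
  have a4 : |(-4 : ℝ)| = 4 := by norm_num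
  have a3 : |(-3 : ℝ)| = 3 := by norm_num
  have a6 : |(-6 : ℝ)| = 6 := by norm_num
  have a1 : |(-1 : ℝ)| = 1 := by norm_num
  rw [a4, a3, a6, a1] at t
  refine le_trans (le_of_eq ?_) (t.trans ?_)
  · congr 1; ring
  · linarith

lemma Good.f5 {m c : ℝ} {f : ℕ → ℝ → ℝ} (h : Good m c f) (hc : 0 ≤ c) (hm : 0 < m) (hm1 : m ≤ 1)
    (x : ℝ) : |f 5 x| ≤ 2000 := by
  have h1 := h.b1 x
  have h2 := h.f2_abs hc hm x
  have h3 := h.f3 hc hm hm1 x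
  have h4 := h.f4 hc hm hm1 x
  have h5 := h.b5 x
  unfold G5 at h5
  have m1 : |m| ≤ 1 := by rw [abs_of_pos hm]; exact hm1
  have n : ∀ r : ℝ, |r| ≤ |r| := fun r => le_rfl
  have t1 := abs_mul_le' (abs_mul_le' (abs_mul_le' (n (-5)) m1) h1) h4
  have t2 := abs_mul_le' (abs_mul_le' (abs_mul_le' (n (-10)) m1) h2) h3
  have t3 := abs_mul_le' (abs_mul_le' (abs_mul_le' (n (-10)) (abs_mul_le' m1 m1))
    (abs_mul_le' h1 h1)) h3
  have t4 := abs_mul_le' (abs_mul_le' (abs_mul_le' (n (-15)) (abs_mul_le' m1 m1)) h1)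
    (abs_mul_le' h2 h2)
  have t5 := abs_mul_le' (abs_mul_le' (abs_mul_le' (n (-10)) (abs_mul_le' (abs_mul_le' m1 m1) m1))
    (abs_mul_le' (abs_mul_le' h1 h1) h1)) h2
  have t6 := abs_mul_le' (abs_mul_le' (n (-1)) (abs_mul_le' (abs_mul_le' m1 m1) (abs_mul_le' m1 m1)))
    (abs_mul_le' (abs_mul_le' (abs_mul_le' h1 h1) (abs_mul_le' h1 h1)) h1)
  have t := abs_add_le' (abs_add_le' (abs_add_le' (abs_add_le' (abs_add_le' (abs_add_le'
    h5 t1) t2) t3) t4) t5) t6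
  have a5 : |(-5 : ℝ)| = 5 := by norm_num
  have a10 : |(-10 : ℝ)| = 10 := by norm_num
  have a15 : |(-15 : ℝ)| = 15 := by norm_num
  have a1 : |(-1 : ℝ)| = 1 := by norm_num
  rw [a5, a10, a15, a1] at t
  refine le_trans (le_of_eq ?_) (t.trans ?_)
  · congr 1; ring
  · linarith

lemma Good.mono {m m' c : ℝ} {f : ℕ → ℝ → ℝ} (h : Good m c f) (hc : 0 ≤ c) (hm' : 0 < m')
    (hmm : m' ≤ m) (hm1 : m ≤ 1) : Good m' c f := by
  have hm : 0 < m := hm'.trans_le hmm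
  have m1 : |m| ≤ 1 := by rw [abs_of_pos hm]; exact hm1
  have m1' : |m'| ≤ 1 := by rw [abs_of_pos hm']; linarith
  have md : |m - m'| ≤ m - m' := by rw [abs_of_nonneg (by linarith)]
  have n : ∀ r : ℝ, |r| ≤ |r| := fun r => le_rfl
  have a3 : |(-3 : ℝ)| = 3 := by norm_num
  have a6 : |(-6 : ℝ)| = 6 := by norm_num
  have a4 : |(-4 : ℝ)| = 4 := by norm_num
  have a5 : |(-5 : ℝ)| = 5 := by norm_num
  have a10 : |(-10 : ℝ)| = 10 := by norm_num
  have a15 : |(-15 : ℝ)| = 15 := by norm_num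
  have a1 : |(-1 : ℝ)| = 1 := by norm_num
  refine ⟨h.der, h.b1, h.low, fun x => ?_, fun x => ?_, fun x => ?_, fun x => ?_⟩
  · have := h.b2 x
    have := mul_le_mul_of_nonneg_right hmm (sq_nonneg (f 1 x))
    linarith
  · have h1 := h.b1 x
    have h2 := h.b2 x
    have h20 := h.f2_nonneg hc x
    have h3 := h.b3 x
    have h12 := f12 hm h1 h20 h2
    unfold G3 at h3 ⊢
    set p := f 1 x
    set q := f 2 x
    have e : f 3 x + 3 * m' * p * q + m' ^ 2 * p ^ 3 = (f 3 x + 3 * m * p * q + m ^ 2 * p ^ 3)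
      + (-(m - m')) * (3 * (p * q) + (m + m') * p ^ 3) := by ring
    have a0 := abs_nonneg p
    have k1 : |3 * (p * q)| ≤ 3 * (|p| * (1 - m * p ^ 2)) := by
      rw [abs_mul, abs_of_pos (by positivity : (0:ℝ) < 3)]
      exact mul_le_mul_of_nonneg_left h12 (by positivity)
    have k2 : |(m + m') * p ^ 3| = (m + m') * (|p| * p ^ 2) := by
      rw [abs_mul, abs_of_pos (by positivity : 0 < m + m'), abs_pow]
      rw [← sq_abs p]; ring
    have k3 : |3 * (p * q) + (m + m') * p ^ 3| ≤ 3 := by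
      refine (abs_add_le' k1 k2.le).trans ?_
      have : 0 ≤ (2 * m - m') * (|p| * p ^ 2) := mul_nonneg (by linarith) (by positivity)
      linarith
    rw [e]
    have md' : |(-(m - m'))| ≤ m - m' := by rw [abs_neg]; exact md
    refine (abs_add_le' h3 (abs_mul_le' md' k3)).trans ?_
    linarith
  · have h1 := h.b1 x
    have h2 := h.f2_abs hc hm x
    have h3 := h.f3 hc hm hm1 x
    have h4 := h.b4 x
    unfold G4 at h4 ⊢
    have t1 := abs_mul_le' (abs_mul_le' (n (-4)) h1) h3
    have t2 := abs_mul_le' (n (-3)) (abs_mul_le' h2 h2)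
    have t3 := abs_mul_le' (abs_mul_le' (abs_mul_le' (n (-6)) (abs_add_le' m1 m1'))
      (abs_mul_le' h1 h1)) h2
    have t4 := abs_mul_le' (abs_mul_le' (n (-1)) (abs_add_le' (abs_add_le' (abs_mul_le' m1 m1) (abs_mul_le' m1 m1'))
      (abs_mul_le' m1' m1')))
      (abs_mul_le' (abs_mul_le' h1 h1) (abs_mul_le' h1 h1))
    have t := abs_add_le' h4 (abs_mul_le' md (abs_add_le' (abs_add_le' (abs_add_le' t1 t2) t3) t4))
    rw [a4, a3, a6, a1] at t
    refine le_trans (le_of_eq ?_) (t.trans ?_)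
    · congr 1; ring
    · linarith
  · have h1 := h.b1 x
    have h2 := h.f2_abs hc hm x
    have h3 := h.f3 hc hm hm1 x
    have h4 := h.f4 hc hm hm1 x
    have h5 := h.b5 x
    unfold G5 at h5 ⊢
    have t1 := abs_mul_le' (abs_mul_le' (n (-5)) h1) h4
    have t2 := abs_mul_le' (abs_mul_le' (n (-10)) h2) h3
    have t3 := abs_mul_le' (abs_mul_le' (abs_mul_le' (n (-10)) (abs_add_le' m1 m1'))
      (abs_mul_le' h1 h1)) h3
    have t4 := abs_mul_le' (abs_mul_le' (abs_mul_le' (n (-15)) (abs_add_le' m1 m1')) h1)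
      (abs_mul_le' h2 h2)
    have t5 := abs_mul_le' (abs_mul_le' (abs_mul_le' (n (-10)) (abs_add_le' (abs_add_le'
      (abs_mul_le' m1 m1) (abs_mul_le' m1 m1')) (abs_mul_le' m1' m1')))
      (abs_mul_le' (abs_mul_le' h1 h1) h1)) h2
    have t6 := abs_mul_le' (abs_mul_le' (abs_mul_le' (n (-1)) (abs_add_le' m1 m1'))
      (abs_add_le' (abs_mul_le' m1 m1) (abs_mul_le' m1' m1')))
      (abs_mul_le' (abs_mul_le' (abs_mul_le' h1 h1) (abs_mul_le' h1 h1)) h1)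
    have t := abs_add_le' h5 (abs_mul_le' md (abs_add_le' (abs_add_le' (abs_add_le' (abs_add_le'
      (abs_add_le' t1 t2) t3) t4) t5) t6))
    rw [a5, a10, a15, a1] at t
    refine le_trans (le_of_eq ?_) (t.trans ?_)
    · congr 1; ring
    · linarith

/-- the chain of `e^{mf}` -/
def expChain (m : ℝ) (f : ℕ → ℝ → ℝ) : ℕ → ℝ → ℝ
  | 0 => fun x => exp (m * f 0 x)
  | 1 => fun x => m * f 1 x * exp (m * f 0 x)
  | 2 => fun x => m * (f 2 x + m * f 1 x ^ 2) * exp (m * f 0 x)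
  | 3 => fun x => m * G3 m f x * exp (m * f 0 x)
  | 4 => fun x => m * G4 m f x * exp (m * f 0 x)
  | 5 => fun x => m * G5 m f x * exp (m * f 0 x)
  | _ => fun _ => 0

lemma expChain_chain {f : ℕ → ℝ → ℝ} (h : Chain f) (m : ℝ) : Chain (expChain m f) := by
  intro j hj x
  have d0 := h 0 (by norm_num) x
  have d1 := h 1 (by norm_num) x
  have d2 := h 2 (by norm_num) x
  have d3 := h 3 (by norm_num) x
  have d4 := h 4 (by norm_num) x
  norm_num at d0 d1 d2 d3 d4
  have e := (d0.const_mul m).exp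
  interval_cases j
  · simp only [expChain]
    refine HasDerivAt.congr_deriv (e) ?_
    ring
  · simp only [expChain]
    refine HasDerivAt.congr_deriv ((d1.const_mul m).fun_mul e) ?_
    ring
  · simp only [expChain, G3]
    refine HasDerivAt.congr_deriv (((d2.fun_add ((d1.fun_pow 2).const_mul m)).const_mul m).fun_mul e) ?_
    push_cast; ring
  · simp only [expChain, G3, G4]
    refine HasDerivAt.congr_deriv ((((d3.fun_add ((d1.const_mul (3 * m)).fun_mul d2)).fun_add
      ((d1.fun_pow 3).const_mul (m ^ 2))).const_mul m).fun_mul e) ?_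
    push_cast; ring
  · simp only [expChain, G5, G4]
    refine HasDerivAt.congr_deriv ((((((d4.fun_add ((d1.const_mul (4 * m)).fun_mul d3)).fun_add
      ((d2.fun_pow 2).const_mul (3 * m))).fun_add (((d1.fun_pow 2).const_mul (6 * m ^ 2)).fun_mul d2)).fun_add
      ((d1.fun_pow 4).const_mul (m ^ 3))).const_mul m).fun_mul e) ?_
    push_cast; ring

/-- from a positive chain `H` to the chain of `m⁻¹ log H` -/
lemma fromH {m c : ℝ} (hm : 0 < m) (H : ℕ → ℝ → ℝ) (hH : Chain H) (pos : ∀ x, 0 < H 0 x)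
    (h1 : ∀ x, |H 1 x| ≤ m * H 0 x) (h2 : ∀ x, H 2 x ≤ m * H 0 x)
    (h3 : ∀ x, |H 3 x| ≤ m * (4 - 3 * m) * H 0 x)
    (h4 : ∀ x, |H 4 x| ≤ m * (40 - 39 * m) * H 0 x)
    (h5 : ∀ x, |H 5 x| ≤ m * (1000 - 999 * m) * H 0 x)
    (low : ∀ x, c / Real.cosh x ^ 2 ≤ H 2 x / (m * H 0 x) - m * (H 1 x / (m * H 0 x)) ^ 2) :
    ∃ f : ℕ → ℝ → ℝ, (∀ x, f 0 x = m⁻¹ * log (H 0 x)) ∧ Good m c f := by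
  set g : ℕ → ℝ → ℝ := fun j x => H j x / (m * H 0 x) with hg
  have dg : ∀ j < 5, ∀ x, HasDerivAt (g j) (g (j + 1) x - m * g 1 x * g j x) x := by
    intro j hj x
    have := (hH j hj x).fun_div ((hH 0 (by norm_num) x).const_mul m) (mul_pos hm (pos x)).ne'
    refine HasDerivAt.congr_deriv (this) ?_
    simp only [hg]
    have := (pos x).ne'
    field_simp
  set p1 : ℝ → ℝ := g 1 with hp1
  set p2 : ℝ → ℝ := fun x => g 2 x - m * p1 x ^ 2 with hp2
  set p3 : ℝ → ℝ := fun x => g 3 x - (3 * m) * p1 x * p2 x - m ^ 2 * p1 x ^ 3 with hp3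
  set p4 : ℝ → ℝ := fun x => g 4 x - 4 * m * p1 x * p3 x - 3 * m * p2 x ^ 2
    - 6 * m ^ 2 * p1 x ^ 2 * p2 x - m ^ 3 * p1 x ^ 4 with hp4
  set p5 : ℝ → ℝ := fun x => g 5 x - 5 * m * p1 x * p4 x - 10 * m * p2 x * p3 x
    - 10 * m ^ 2 * p1 x ^ 2 * p3 x
    - 15 * m ^ 2 * p1 x * p2 x ^ 2 - 10 * m ^ 3 * p1 x ^ 3 * p2 x - m ^ 4 * p1 x ^ 5 with hp5
  have d0 : ∀ x, HasDerivAt (fun x => m⁻¹ * log (H 0 x)) (p1 x) x := by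
    intro x
    refine HasDerivAt.congr_deriv (((hH 0 (by norm_num) x).log (pos x).ne').const_mul m⁻¹) ?_
    simp only [hp1, hg]
    have := (pos x).ne'
    field_simp
  have d1 : ∀ x, HasDerivAt p1 (p2 x) x := by
    intro x
    refine HasDerivAt.congr_deriv (dg 1 (by norm_num) x) ?_
    simp only [hp2, hp1]; ring
  have d2 : ∀ x, HasDerivAt p2 (p3 x) x := by
    intro x
    refine HasDerivAt.congr_deriv ((dg 2 (by norm_num) x).fun_sub (((d1 x).fun_pow 2).const_mul m)) ?_
    have e2 : g 2 x = p2 x + m * p1 x ^ 2 := by simp only [hp2]; ring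
    simp only [hp3]
    rw [e2]; norm_num; ring
  have d3 : ∀ x, HasDerivAt p3 (p4 x) x := by
    intro x
    refine HasDerivAt.congr_deriv (((dg 3 (by norm_num) x).fun_sub (((d1 x).const_mul (3 * m)).fun_mul (d2 x))).fun_sub
      (((d1 x).fun_pow 3).const_mul (m ^ 2))) ?_
    have e3 : g 3 x = p3 x + 3 * m * p1 x * p2 x + m ^ 2 * p1 x ^ 3 := by simp only [hp3]; ring
    simp only [hp4]
    rw [e3]; norm_num; ring
  have d4 : ∀ x, HasDerivAt p4 (p5 x) x := by
    intro x
    refine HasDerivAt.congr_deriv (((((dg 4 (by norm_num) x).fun_sub (((d1 x).const_mul (4 * m)).fun_mul (d3 x))).fun_sub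
      (((d2 x).fun_pow 2).const_mul (3 * m))).fun_sub
      ((((d1 x).fun_pow 2).const_mul (6 * m ^ 2)).fun_mul (d2 x))).fun_sub
      (((d1 x).fun_pow 4).const_mul (m ^ 3))) ?_
    have e4 : g 4 x = p4 x + 4 * m * p1 x * p3 x + 3 * m * p2 x ^ 2
      + 6 * m ^ 2 * p1 x ^ 2 * p2 x + m ^ 3 * p1 x ^ 4 := by simp only [hp4]; ring
    simp only [hp5]
    rw [e4]; norm_num; ring
  set f : ℕ → ℝ → ℝ := fun j => match j with
    | 0 => fun x => m⁻¹ * log (H 0 x)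
    | 1 => p1 | 2 => p2 | 3 => p3 | 4 => p4 | 5 => p5 | _ => fun _ => 0 with hf
  have gb : ∀ j x B, |H j x| ≤ m * B * H 0 x → |g j x| ≤ B := by
    intro j x B hB
    have hp := mul_pos hm (pos x)
    simp only [hg]
    rw [abs_div, abs_of_pos hp, div_le_iff₀ hp]
    linarith
  refine ⟨f, fun x => rfl, ?_, ?_, ?_, ?_, ?_, ?_, ?_⟩
  · intro j hj x
    interval_cases j
    · exact d0 x
    · exact d1 x
    · exact d2 x
    · exact d3 x
    · exact d4 x
  · intro x
    exact gb 1 x 1 (by linarith [h1 x])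
  · exact low
  · intro x
    have hp := mul_pos hm (pos x)
    have : g 2 x ≤ 1 := by
      simp only [hg]; rw [div_le_iff₀ hp]; linarith [h2 x]
    simpa only [hf, hp2, sub_add_cancel] using this
  · intro x
    have : G3 m f x = g 3 x := by simp only [G3, hf, hp3]; ring
    rw [this]; exact gb 3 x _ (h3 x)
  · intro x
    have : G4 m f x = g 4 x := by simp only [G4, hf, hp4]; ring
    rw [this]; exact gb 4 x _ (h4 x)
  · intro x
    have : G5 m f x = g 5 x := by simp only [G5, hf, hp5]; ring
    rw [this]; exact gb 5 x _ (h5 x)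

lemma good_base : ∃ f : ℕ → ℝ → ℝ, (∀ x, f 0 x = log (Real.cosh x)) ∧ Good 1 1 f := by
  obtain ⟨f, hf, hg⟩ := fromH (m := 1) (c := 1) one_pos
    (fun j => if Even j then Real.cosh else Real.sinh) (by
      intro j hj x
      interval_cases j
      all_goals norm_num [Nat.even_iff]
      all_goals first | exact Real.hasDerivAt_cosh x | exact Real.hasDerivAt_sinh x)
    (by intro x; simpa using Real.cosh_pos x)
    (by
      intro x
      norm_num [Nat.even_iff]
      rw [abs_le]; exact ⟨by linarith [Real.cosh_add_sinh x, exp_pos x], (Real.sinh_lt_cosh x).le⟩)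
    (by intro x; norm_num [Nat.even_iff])
    (by
      intro x
      norm_num [Nat.even_iff]
      rw [abs_le]; exact ⟨by linarith [Real.cosh_add_sinh x, exp_pos x], (Real.sinh_lt_cosh x).le⟩)
    (by intro x; norm_num [Nat.even_iff, abs_of_pos (Real.cosh_pos x)])
    (by
      intro x
      norm_num [Nat.even_iff]
      rw [abs_le]; exact ⟨by linarith [Real.cosh_add_sinh x, exp_pos x], (Real.sinh_lt_cosh x).le⟩)
    (by
      intro x
      norm_num [Nat.even_iff]
      have := (Real.cosh_pos x).ne'
      have h := Real.cosh_sq x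
      field_simp
      nlinarith)
  exact ⟨f, fun x => by simpa using hf x, hg⟩

lemma hasDeriv_lip {f f' : ℝ → ℝ} {K : ℝ} (hd : ∀ x, HasDerivAt f (f' x) x) (hb : ∀ x, |f' x| ≤ K)
    (x y : ℝ) : |f y - f x| ≤ K * |y - x| := by
  have := convex_univ.norm_image_sub_le_of_norm_hasDerivWithin_le (f := f) (f' := f') (C := K)
    (fun x _ => (hd x).hasDerivWithinAt) (fun x _ => hb x) (mem_univ x) (mem_univ y)
  simpa using this

lemma taylor_lip {f f' : ℝ → ℝ} {K : ℝ} (hd : ∀ x, HasDerivAt f (f' x) x)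
    (hK : ∀ x y, |f' y - f' x| ≤ K * |y - x|) (x y : ℝ) :
    |f (x + y) - f x - f' x * y| ≤ K * y ^ 2 := by
  have hK0 : 0 ≤ K := by have := (abs_nonneg _).trans (hK 0 1); simpa using this
  have h1 : ∀ u, HasDerivAt (fun u => f u - f' x * u) (f' u - f' x) u := by
    intro u
    exact ((hd u).fun_sub ((hasDerivAt_id u).const_mul (f' x))).congr_deriv (by simp)
  have := (convex_uIcc x (x + y)).norm_image_sub_le_of_norm_hasDerivWithin_le
    (f := fun u => f u - f' x * u) (f' := fun u => f' u - f' x) (C := K * |y|)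
    (fun u _ => (h1 u).hasDerivWithinAt) (fun u hu => by
      refine (hK x u).trans (mul_le_mul_of_nonneg_left ?_ hK0)
      have := abs_sub_left_of_mem_uIcc hu
      simpa using this) left_mem_uIcc right_mem_uIcc
  simp only [Real.norm_eq_abs] at this
  have e : f (x + y) - f x - f' x * y = f (x + y) - f' x * (x + y) - (f x - f' x * x) := by ring
  rw [e]
  refine this.trans (le_of_eq ?_)
  rw [add_sub_cancel_left, mul_assoc, abs_mul_abs_self]; ring

lemma Good.lip {m c : ℝ} {f : ℕ → ℝ → ℝ} (h : Good m c f) (x y : ℝ) :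
    |f 0 y - f 0 x| ≤ |y - x| := by
  simpa using hasDeriv_lip (fun x => h.der 0 (by norm_num) x) h.b1 x y

lemma cosh_bound (x : ℝ) : ∃ t : ℝ, |t| ≤ 1 ∧ ∀ y, Real.cosh (x + y) ^ 2 ≤
    Real.cosh x ^ 2 * exp (2 * t * y + 2 * y ^ 2) := by
  obtain ⟨f, hf, hg⟩ := good_base
  refine ⟨f 1 x, hg.b1 x, fun y => ?_⟩
  have h1 := taylor_lip (K := 1) (fun x => hg.der 0 (by norm_num) x)
    (hasDeriv_lip (fun x => hg.der 1 (by norm_num) x) (hg.f2_abs zero_le_one one_pos)) x y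
  have h2 := (abs_le.1 h1).2
  rw [hf, hf] at h2
  norm_num at h2
  have e : ∀ u, Real.cosh u ^ 2 = exp (2 * log (Real.cosh u)) := by
    intro u
    rw [two_mul, exp_add, exp_log (Real.cosh_pos u)]; ring
  rw [e, e, ← exp_add]
  exact exp_le_exp.2 (by linarith)

/-- the standard Gaussian measure -/
abbrev γ : Measure ℝ := gaussianReal 0 1

lemma int_exp_abs (a : ℝ) : Integrable (fun z : ℝ => exp (a * |z|)) γ :=
  integrable_exp_mul_abs (X := fun z => z) (integrable_exp_mul_gaussianReal a)
    (integrable_exp_mul_gaussianReal (-a))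

lemma int_sq_exp_abs (a : ℝ) : Integrable (fun z : ℝ => z ^ 2 * exp (a * |z|)) γ := by
  refine ((int_exp_abs (a + 1)).const_mul 2).mono' (by fun_prop) (ae_of_all _ fun z => ?_)
  rw [Real.norm_eq_abs, abs_of_nonneg (by positivity), add_mul, exp_add, one_mul]
  have := Real.quadratic_le_exp_of_nonneg (abs_nonneg z)
  rw [sq_abs] at this
  have h0 := abs_nonneg z
  have h1 := exp_pos (a * |z|)
  nlinarith

def cC1 (V : ℝ) : ℝ := ∫ z, z ^ 2 * exp (√V * |z|) ∂γ
def cC0 (V : ℝ) : ℝ := ∫ z, exp (-√V * |z|) ∂γ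
def cK (V : ℝ) : ℝ := 4 * cC1 V / cC0 V

lemma cC0_pos (V : ℝ) : 0 < cC0 V := by
  have := integral_exp_pos (μ := γ) (int_exp_abs (-√V))
  exact this

lemma cC1_nonneg (V : ℝ) : 0 ≤ cC1 V := integral_nonneg fun z => by positivity

lemma cK_nonneg (V : ℝ) : 0 ≤ cK V := by
  have := cC0_pos V
  have := cC1_nonneg V
  unfold cK; positivity

/-- exponential growth of rate one -/
structure Grow (F : ℝ → ℝ) : Prop where
  pos : ∀ x, 0 < F x
  up : ∀ x y, F (x + y) ≤ F x * exp |y|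
  dn : ∀ x y, F x * exp (-|y|) ≤ F (x + y)
  cont : Continuous F

lemma Grow.bd {F : ℝ → ℝ} (h : Grow F) (x σ z : ℝ) : F (x + z * σ) ≤ F x * exp (|σ| * |z|) := by
  have := h.up x (z * σ)
  rwa [abs_mul, mul_comm |z|] at this

lemma Grow.int {F : ℝ → ℝ} (h : Grow F) {k : ℝ → ℝ} (hk : Measurable k) {B : ℝ}
    (hB : ∀ x, |k x| ≤ B * F x) (x σ : ℝ) : Integrable (fun z => k (x + z * σ)) γ := by
  have hB0 : 0 ≤ B := by
    have := (abs_nonneg _).trans (hB 0)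
    exact nonneg_of_mul_nonneg_left this (h.pos 0)
  refine ((int_exp_abs |σ|).const_mul (B * F x)).mono' ?_ (ae_of_all _ fun z => ?_)
  · exact (hk.comp (by fun_prop)).aestronglyMeasurable
  · rw [Real.norm_eq_abs]
    refine (hB _).trans ?_
    rw [mul_assoc]
    exact mul_le_mul_of_nonneg_left (h.bd x σ z) hB0

lemma Grow.int0 {F : ℝ → ℝ} (h : Grow F) (x σ : ℝ) : Integrable (fun z => F (x + z * σ)) γ :=
  h.int h.cont.measurable (B := 1) (fun x => by rw [abs_of_pos (h.pos x), one_mul]) x σ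

lemma Grow.deriv {F : ℝ → ℝ} (h : Grow F) {k k' : ℝ → ℝ} (hd : ∀ x, HasDerivAt k (k' x) x)
    {B B' : ℝ} (hB : ∀ x, |k x| ≤ B * F x) (hB' : ∀ x, |k' x| ≤ B' * F x) (x σ : ℝ) :
    HasDerivAt (fun x => ∫ z, k (x + z * σ) ∂γ) (∫ z, k' (x + z * σ) ∂γ) x := by
  have hk : Continuous k := continuous_iff_continuousAt.2 fun x => (hd x).continuousAt
  have hk' : Measurable k' := by
    have : k' = _root_.deriv k := funext fun x => (hd x).deriv.symm
    rw [this]; exact measurable_deriv k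
  have hB0 : 0 ≤ B' := by
    have := (abs_nonneg _).trans (hB' 0)
    exact nonneg_of_mul_nonneg_left this (h.pos 0)
  refine (hasDerivAt_integral_of_dominated_loc_of_deriv_le (μ := γ) (s := Metric.ball x 1)
    (bound := fun z => B' * (F x * exp 1) * exp (|σ| * |z|))
    (F := fun x z => k (x + z * σ)) (F' := fun x z => k' (x + z * σ))
    (Metric.ball_mem_nhds x one_pos) ?_ (h.int hk.measurable hB x σ) ?_ ?_ ?_ ?_).2
  · exact Eventually.of_forall fun u => (h.int hk.measurable hB u σ).1
  · exact (h.int hk' hB' x σ).1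
  · refine ae_of_all _ fun z u hu => ?_
    rw [Real.norm_eq_abs, mul_assoc]
    refine (hB' _).trans (mul_le_mul_of_nonneg_left ?_ hB0)
    refine (h.bd u σ z).trans (mul_le_mul_of_nonneg_right ?_ (exp_pos _).le)
    have := h.up x (u - x)
    rw [add_sub_cancel] at this
    refine this.trans (mul_le_mul_of_nonneg_left (exp_le_exp.2 ?_) (h.pos x).le)
    rw [Metric.mem_ball, Real.dist_eq] at hu
    exact hu.le
  · exact (int_exp_abs |σ|).const_mul _
  · refine ae_of_all _ fun z u _ => ?_
    exact (hd (u + z * σ)).comp_add_const u (z * σ)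

lemma Grow.sech {F : ℝ → ℝ} (h : Grow F) {v V : ℝ} (hv : 0 ≤ v) (hvV : v ≤ V) (x : ℝ) :
    exp (-(cK V * v)) / Real.cosh x ^ 2 * ∫ z, F (x + z * √v) ∂γ ≤
      ∫ z, F (x + z * √v) / Real.cosh (x + z * √v) ^ 2 ∂γ := by
  obtain ⟨t, ht, hc⟩ := cosh_bound x
  have hF := h.pos x
  set H := ∫ z, F (x + z * √v) ∂γ with hH
  set w := cK V * v with hw
  have C0 := cC0_pos V
  have C1 := cC1_nonneg V
  have hsv : √v ≤ √V := Real.sqrt_le_sqrt hvV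
  have hHlow : F x * cC0 V ≤ H := by
    rw [hH, cC0, ← integral_const_mul]
    refine integral_mono ((int_exp_abs _).const_mul _) (h.int0 x _) fun z => ?_
    refine le_trans ?_ (h.dn x (z * √v))
    refine mul_le_mul_of_nonneg_left (exp_le_exp.2 ?_) hF.le
    rw [abs_mul, abs_of_nonneg (Real.sqrt_nonneg v)]
    nlinarith [abs_nonneg z]
  have hkey : ∀ z, exp (-w) / Real.cosh x ^ 2 * ((1 + w) * F (x + z * √v) - (2 * t * F x * √v) * z
      - 4 * F x * v * (z ^ 2 * exp (√V * |z|))) ≤ F (x + z * √v) / Real.cosh (x + z * √v) ^ 2 := by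
    intro z
    set y := z * √v with hy
    have hy2 : y ^ 2 = v * z ^ 2 := by rw [hy, mul_pow, Real.sq_sqrt hv]; ring
    have hya : |y| ≤ √V * |z| := by
      rw [hy, abs_mul, abs_of_nonneg (Real.sqrt_nonneg v), mul_comm]
      exact mul_le_mul_of_nonneg_right hsv (abs_nonneg _)
    have hFy := h.pos (x + y)
    have ey := exp_pos |y|
    have e1 : exp |y| ≤ exp (√V * |z|) := exp_le_exp.2 hya
    have s1 : |F (x + y) - F x| ≤ F x * (|y| * exp |y|) := by
      have u1 := h.up x y
      have u2 := h.dn x y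
      have a0 := abs_nonneg y
      have q1 := Real.add_one_le_exp (-|y|)
      have q2 : exp (-|y|) * exp |y| = 1 := by rw [← exp_add]; simp
      have q3 : exp |y| - 1 ≤ |y| * exp |y| := by nlinarith
      have q4 : 1 - exp (-|y|) ≤ |y| * exp |y| := by
        have := Real.one_le_exp a0
        nlinarith
      rw [abs_le]; constructor <;> nlinarith
    have s2 : F (x + y) * (2 * t * y + 2 * y ^ 2) ≤ (2 * t * F x * y)
        + 4 * F x * (y ^ 2 * exp |y|) := by
      have r1 : t * y * (F (x + y) - F x) ≤ F x * (y ^ 2 * exp |y|) := by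
        refine (le_abs_self _).trans ?_
        have ty : |t * y| ≤ |y| := by
          rw [abs_mul]; nlinarith [abs_nonneg y, abs_nonneg t]
        refine (abs_mul_le' ty s1).trans (le_of_eq ?_)
        rw [← sq_abs y]; ring
      have r2 : F (x + y) * y ^ 2 ≤ F x * (y ^ 2 * exp |y|) := by
        have := mul_le_mul_of_nonneg_right (h.up x y) (sq_nonneg y)
        linarith
      linarith
    have s3 : 4 * F x * (y ^ 2 * exp |y|) ≤ 4 * F x * v * (z ^ 2 * exp (√V * |z|)) := by
      rw [hy2]
      have : v * z ^ 2 * exp |y| ≤ v * z ^ 2 * exp (√V * |z|) :=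
        mul_le_mul_of_nonneg_left e1 (by positivity)
      nlinarith
    set W := 2 * t * y + 2 * y ^ 2 with hW
    have s4 : exp (-w) * (1 + w - W) ≤ exp (-W) := by
      have := Real.add_one_le_exp (w - W)
      have e : exp (-W) = exp (-w) * exp (w - W) := by rw [← exp_add]; ring_nf
      rw [e]; exact mul_le_mul_of_nonneg_left (by linarith) (exp_pos _).le
    have hcx : 0 < Real.cosh x ^ 2 := by positivity
    have hcy : 0 < Real.cosh (x + y) ^ 2 := by positivity
    have s5 : F (x + y) * exp (-W) / Real.cosh x ^ 2 ≤ F (x + y) / Real.cosh (x + y) ^ 2 := by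
      rw [div_le_div_iff₀ hcx hcy]
      have := hc y
      have e : exp (-W) * exp W = 1 := by rw [← exp_add]; simp
      calc F (x + y) * exp (-W) * Real.cosh (x + y) ^ 2
          ≤ F (x + y) * exp (-W) * (Real.cosh x ^ 2 * exp W) :=
            mul_le_mul_of_nonneg_left this (by positivity)
        _ = F (x + y) * Real.cosh x ^ 2 * (exp (-W) * exp W) := by ring
        _ = _ := by rw [e, mul_one]
    refine le_trans ?_ s5
    rw [div_mul_eq_mul_div]
    refine div_le_div_of_nonneg_right ?_ hcx.le
    have s6 := mul_le_mul_of_nonneg_left s4 hFy.le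
    refine le_trans ?_ s6
    have s7 : (1 + w) * F (x + y) - (2 * t * F x * √v) * z
      - 4 * F x * v * (z ^ 2 * exp (√V * |z|)) ≤ F (x + y) * (1 + w - W) := by
      have : (2 * t * F x * √v) * z = 2 * t * F x * y := by rw [hy]; ring
      rw [this]; linarith
    have := mul_le_mul_of_nonneg_left s7 (exp_pos (-w)).le
    linarith
  have hIntegr : Integrable (fun z => F (x + z * √v) / Real.cosh (x + z * √v) ^ 2) γ := by
    refine h.int (k := fun u => F u / Real.cosh u ^ 2) (B := 1) ?_ ?_ x (√v)
    · exact (h.cont.div (by fun_prop) (fun u => by positivity)).measurable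
    · intro u
      rw [abs_of_nonneg (by have := h.pos u; positivity), one_mul]
      exact div_le_self (h.pos u).le (one_le_pow₀ (Real.one_le_cosh u))
  have hz : Integrable (fun z : ℝ => z) γ := by
    have := (memLp_id_gaussianReal (μ := 0) (v := 1) 1)
    exact memLp_one_iff_integrable.1 this
  have i1 : Integrable (fun z => (1 + w) * F (x + z * √v)) γ := (h.int0 x _).const_mul _
  have i2 : Integrable (fun z => (2 * t * F x * √v) * z) γ := hz.const_mul _
  have i3 : Integrable (fun z => 4 * F x * v * (z ^ 2 * exp (√V * |z|))) γ :=
    (int_sq_exp_abs _).const_mul _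
  have := integral_mono (((i1.sub i2).sub i3).const_mul (exp (-w) / Real.cosh x ^ 2)) hIntegr hkey
  refine le_trans ?_ this
  rw [integral_const_mul]
  simp only [Pi.sub_apply]
  refine mul_le_mul_of_nonneg_left ?_ (by positivity)
  have e : ∫ z, ((1 + w) * F (x + z * √v) - (2 * t * F x * √v) * z
      - 4 * F x * v * (z ^ 2 * exp (√V * |z|))) ∂γ
      = (1 + w) * H - 0 - 4 * F x * v * cC1 V := by
    have i12 : Integrable (fun z => (1 + w) * F (x + z * √v) - (2 * t * F x * √v) * z) γ :=
      i1.sub i2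
    rw [integral_sub i12 i3, integral_sub i1 i2, integral_const_mul, integral_const_mul,
      integral_const_mul, integral_id_gaussianReal, mul_zero]
    rfl
  rw [e]
  have e2 : 4 * F x * v * cC1 V = w * (F x * cC0 V) := by
    rw [hw, cK]; field_simp
  have hw0 : 0 ≤ w := mul_nonneg (cK_nonneg V) hv
  rw [e2]
  nlinarith [mul_le_mul_of_nonneg_left hHlow hw0]

lemma Good.grow {m c : ℝ} {f : ℕ → ℝ → ℝ} (h : Good m c f) (hm : 0 < m) (hm1 : m ≤ 1) :
    Grow (fun x => exp (m * f 0 x)) := by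
  have key : ∀ x y, |m * f 0 (x + y) - m * f 0 x| ≤ |y| := by
    intro x y
    have := h.lip x (x + y)
    rw [add_sub_cancel_left] at this
    rw [← mul_sub, abs_mul, abs_of_pos hm]
    nlinarith [abs_nonneg y, abs_nonneg (f 0 (x + y) - f 0 x)]
  refine ⟨fun x => exp_pos _, fun x y => ?_, fun x y => ?_, ?_⟩
  · rw [← exp_add]; exact exp_le_exp.2 (by linarith [(abs_le.1 (key x y)).2])
  · rw [← exp_add]; exact exp_le_exp.2 (by linarith [(abs_le.1 (key x y)).1])
  · have : Continuous (f 0) :=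
      continuous_iff_continuousAt.2 fun x => (h.der 0 (by norm_num) x).continuousAt
    fun_prop

lemma good_step {m c : ℝ} {f : ℕ → ℝ → ℝ} (h : Good m c f) (hc : 0 ≤ c) (hm : 0 < m) (hm1 : m ≤ 1)
    {v V : ℝ} (hv : 0 ≤ v) (hvV : v ≤ V) :
    ∃ g : ℕ → ℝ → ℝ, (∀ x, g 0 x = m⁻¹ * log (∫ z, exp (m * f 0 (x + z * √v)) ∂γ)) ∧
      Good m (c * exp (-(cK V * v))) g := by
  have hG := h.grow hm hm1
  set E := expChain m f with hE
  have hEc : Chain E := expChain_chain h.der m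
  have hE0 : E 0 = fun x => exp (m * f 0 x) := rfl
  have ep : ∀ x, 0 < exp (m * f 0 x) := fun x => exp_pos _
  have bb : ∀ x (g B : ℝ), |g| ≤ B → |m * g * exp (m * f 0 x)| ≤ m * B * E 0 x := by
    intro x g B hg
    rw [abs_mul, abs_mul, abs_of_pos hm, abs_of_pos (ep x)]
    exact mul_le_mul_of_nonneg_right (mul_le_mul_of_nonneg_left hg hm.le) (ep x).le
  have b1 : ∀ x, |E 1 x| ≤ m * 1 * E 0 x := fun x => bb x _ _ (h.b1 x)
  have b2 : ∀ x, |E 2 x| ≤ m * 1 * E 0 x := fun x => bb x _ _ (by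
    rw [abs_of_nonneg (add_nonneg (h.f2_nonneg hc x) (by positivity))]; exact h.b2 x)
  have b3 : ∀ x, |E 3 x| ≤ m * (4 - 3 * m) * E 0 x := fun x => bb x _ _ (h.b3 x)
  have b4 : ∀ x, |E 4 x| ≤ m * (40 - 39 * m) * E 0 x := fun x => bb x _ _ (h.b4 x)
  have b5 : ∀ x, |E 5 x| ≤ m * (1000 - 999 * m) * E 0 x := fun x => bb x _ _ (h.b5 x)
  have b0 : ∀ x, |E 0 x| ≤ 1 * E 0 x := fun x => by rw [hE0, abs_of_pos (ep x), one_mul]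
  have ball : ∀ j ≤ 5, ∃ B : ℝ, ∀ x, |E j x| ≤ B * E 0 x := by
    intro j hj
    interval_cases j
    exacts [⟨_, b0⟩, ⟨_, b1⟩, ⟨_, b2⟩, ⟨_, b3⟩, ⟨_, b4⟩, ⟨_, b5⟩]
  have meas : ∀ j ≤ 5, Measurable (E j) := by
    intro j hj
    rcases Nat.eq_zero_or_pos j with rfl | hj0
    · exact hG.cont.measurable
    · obtain ⟨i, rfl⟩ := Nat.exists_eq_succ_of_ne_zero hj0.ne'
      have : E (i + 1) = deriv (E i) := funext fun x => (hEc i (by omega) x).deriv.symm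
      rw [Nat.succ_eq_add_one, this]; exact measurable_deriv _
  have int : ∀ j ≤ 5, ∀ x, Integrable (fun z => E j (x + z * √v)) γ := by
    intro j hj x
    obtain ⟨B, hB⟩ := ball j hj
    exact hG.int (meas j hj) hB x _
  set H : ℕ → ℝ → ℝ := fun j x => ∫ z, E j (x + z * √v) ∂γ with hH
  have hbd : ∀ j ≤ 5, ∀ B : ℝ, (∀ x, |E j x| ≤ B * E 0 x) → ∀ x, |H j x| ≤ B * H 0 x := by
    intro j hj B hB x
    simp only [hH]
    rw [← integral_const_mul]
    refine (abs_integral_le_integral_abs).trans ?_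
    exact integral_mono (int j hj x).abs ((int 0 (by norm_num) x).const_mul _) fun z => hB _
  have pos : ∀ x, 0 < H 0 x := fun x => integral_exp_pos (int 0 (by norm_num) x)
  have hHc : Chain H := by
    intro j hj x
    obtain ⟨B, hB⟩ := ball j (by omega)
    obtain ⟨B', hB'⟩ := ball (j + 1) (by omega)
    exact hG.deriv (hEc j hj) hB hB' x _
  refine fromH hm H hHc pos ?_ ?_ (hbd 3 (by norm_num) _ b3) (hbd 4 (by norm_num) _ b4)
    (hbd 5 (by norm_num) _ b5) ?_
  · intro x; simpa using hbd 1 (by norm_num) _ b1 x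
  · intro x; simpa using (le_abs_self _).trans (hbd 2 (by norm_num) _ b2 x)
  · intro x
    set a := H 1 x / (m * H 0 x) with ha
    have hp := pos x
    have cf1 : Measurable (f 1) := (continuous_iff_continuousAt.2 fun x =>
      (h.der 1 (by norm_num) x).continuousAt).measurable
    have cf2 : Measurable (f 2) := (continuous_iff_continuousAt.2 fun x =>
      (h.der 2 (by norm_num) x).continuousAt).measurable
    have cE : Measurable (E 0) := hG.cont.measurable
    have hm0 : ∀ x : ℝ, ∀ k : ℝ, |k| ≤ 1 → |k * E 0 x| ≤ 1 * E 0 x := by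
      intro x k hk
      rw [hE0, abs_mul, abs_of_pos (ep x)]
      exact mul_le_mul_of_nonneg_right hk (ep x).le
    have j1 : Integrable (fun z => f 1 (x + z * √v) ^ 2 * E 0 (x + z * √v)) γ :=
      hG.int (k := fun u => f 1 u ^ 2 * E 0 u) (B := 1) (by fun_prop) (fun u => hm0 u _ (by
        rw [abs_pow]; exact pow_le_one₀ (abs_nonneg _) (h.b1 u))) x _
    have j2 : Integrable (fun z => f 2 (x + z * √v) * E 0 (x + z * √v)) γ :=
      hG.int (k := fun u => f 2 u * E 0 u) (B := 1) (by fun_prop) (fun u => hm0 u _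
        (h.f2_abs hc hm u)) x _
    have k1 : a ^ 2 * H 0 x ≤ ∫ z, f 1 (x + z * √v) ^ 2 * E 0 (x + z * √v) ∂γ := by
      have i0 := int 0 (by norm_num) x
      have i1 := int 1 (by norm_num) x
      have q : ∫ z, (2 * a / m * E 1 (x + z * √v) - a ^ 2 * E 0 (x + z * √v)) ∂γ
          = a ^ 2 * H 0 x := by
        rw [integral_sub (i1.const_mul _) (i0.const_mul _), integral_const_mul, integral_const_mul]
        change 2 * a / m * H 1 x - a ^ 2 * H 0 x = _
        have : H 1 x = a * (m * H 0 x) := by rw [ha]; field_simp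
        rw [this]; field_simp; ring
      rw [← q]
      refine integral_mono ((i1.const_mul _).sub (i0.const_mul _)) j1 fun z => ?_
      set u := x + z * √v
      have e1 : E 1 u = m * f 1 u * E 0 u := rfl
      simp only [e1]
      have := mul_nonneg (sq_nonneg (f 1 u - a)) (ep u).le
      change 0 ≤ (f 1 u - a) ^ 2 * E 0 u at this
      have e3 : 2 * a / m * (m * f 1 u * E 0 u) = 2 * a * f 1 u * E 0 u := by field_simp
      rw [e3]; nlinarith
    have k2 : H 2 x = m * ((∫ z, f 2 (x + z * √v) * E 0 (x + z * √v) ∂γ)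
        + m * ∫ z, f 1 (x + z * √v) ^ 2 * E 0 (x + z * √v) ∂γ) := by
      rw [← integral_const_mul m, ← integral_add j2 (j1.const_mul m), ← integral_const_mul]
      refine integral_congr_ae (ae_of_all _ fun z => ?_)
      simp only [hE, expChain]; ring
    have k3 : c * exp (-(cK V * v)) / Real.cosh x ^ 2 * H 0 x ≤
        ∫ z, f 2 (x + z * √v) * E 0 (x + z * √v) ∂γ := by
      have s := mul_le_mul_of_nonneg_left (hG.sech hv hvV x) hc
      rw [← mul_assoc, ← mul_div_assoc] at s
      refine le_trans s ?_
      rw [← integral_const_mul]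
      refine integral_mono_of_nonneg (ae_of_all _ fun z => ?_) j2 (ae_of_all _ fun z => ?_)
      · simp only [Pi.zero_apply]; positivity
      · have := mul_le_mul_of_nonneg_right (h.low (x + z * √v)) (ep (x + z * √v)).le
        refine le_trans (le_of_eq ?_) this
        simp only []
        ring
    rw [k2, mul_div_mul_left _ _ hm.ne']
    have : c * exp (-(cK V * v)) / Real.cosh x ^ 2 + m * a ^ 2 ≤
      ((∫ z, f 2 (x + z * √v) * E 0 (x + z * √v) ∂γ)
        + m * ∫ z, f 1 (x + z * √v) ^ 2 * E 0 (x + z * √v) ∂γ) / H 0 x := by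
      rw [le_div_iff₀ hp]
      nlinarith
    linarith
open Topology in
lemma conv_lemma {ι : Type*} {l : Filter ι} [l.NeBot] {g g' : ι → ℝ → ℝ} {G : ℝ → ℝ} {K : ℝ}
    (hd : ∀ᶠ i in l, (∀ x, HasDerivAt (g i) (g' i x) x) ∧ ∀ x y, |g' i y - g' i x| ≤ K * |y - x|)
    (hlim : ∀ x, Tendsto (fun i => g i x) l (𝓝 (G x))) :
    ∃ D : ℝ → ℝ, (∀ x, HasDerivAt G (D x) x) ∧ (∀ x, Tendsto (fun i => g' i x) l (𝓝 (D x))) ∧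
      ∀ x y, |D y - D x| ≤ K * |y - x| := by
  have hK0 : 0 ≤ K := by
    obtain ⟨i, -, h⟩ := hd.exists
    have := (abs_nonneg _).trans (h 0 1); simpa using this
  have hT : ∀ᶠ i in l, ∀ x y, |g i (x + y) - g i x - g' i x * y| ≤ K * y ^ 2 := by
    filter_upwards [hd] with i hi x y
    exact taylor_lip hi.1 hi.2 x y
  have hC : ∀ x, Cauchy (map (fun i => g' i x) l) := by
    intro x
    rw [Metric.cauchy_iff]
    refine ⟨inferInstance, fun ε hε => ?_⟩
    set h := ε / (4 * (K + 1)) with hh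
    have hpos : 0 < h := by positivity
    have hq : Tendsto (fun i => (g i (x + h) - g i x) / h) l (𝓝 ((G (x + h) - G x) / h)) :=
      ((hlim (x + h)).sub (hlim x)).div_const h
    have hev := (Metric.tendsto_nhds.1 hq) (ε / 4) (by positivity)
    refine ⟨Metric.ball ((G (x + h) - G x) / h) (ε / 2), ?_, ?_⟩
    · rw [mem_map]
      filter_upwards [hev, hT] with i h1 h2
      have h3 := h2 x h
      rw [mem_preimage, Metric.mem_ball]
      refine lt_of_le_of_lt (dist_triangle _ ((g i (x + h) - g i x) / h) _) ?_
      have : dist (g' i x) ((g i (x + h) - g i x) / h) ≤ ε / 4 := by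
        rw [dist_comm, Real.dist_eq]
        have e : (g i (x + h) - g i x) / h - g' i x = (g i (x + h) - g i x - g' i x * h) / h := by
          field_simp
        rw [e, abs_div, abs_of_pos hpos, div_le_iff₀ hpos]
        refine h3.trans ?_
        have : ε / 4 = (K + 1) * h := by rw [hh]; field_simp
        rw [this]; nlinarith [sq_nonneg h]
      linarith
    · intro a ha b hb
      rw [Metric.mem_ball] at ha hb
      have := dist_triangle_right a b ((G (x + h) - G x) / h)
      linarith
  choose D hD using fun x => cauchy_iff_exists_le_nhds.1 (hC x)
  have hD' : ∀ x, Tendsto (fun i => g' i x) l (𝓝 (D x)) := hD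
  refine ⟨D, fun x => ?_, hD', fun x y => ?_⟩
  · have hb : ∀ y, |G (x + y) - G x - D x * y| ≤ K * y ^ 2 := by
      intro y
      refine le_of_tendsto ((((hlim (x + y)).sub (hlim x)).sub ((hD' x).mul_const y)).abs) ?_
      filter_upwards [hT] with i hi using hi x y
    rw [hasDerivAt_iff_isLittleO_nhds_zero]
    have h1 : (fun h => G (x + h) - G x - h • D x) =O[𝓝 0] fun h : ℝ => h ^ 2 := by
      refine Asymptotics.IsBigO.of_bound K (Eventually.of_forall fun h => ?_)
      rw [Real.norm_eq_abs, Real.norm_eq_abs, abs_of_nonneg (sq_nonneg h), smul_eq_mul, mul_comm h]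
      exact hb h
    refine h1.trans_isLittleO ?_
    exact Asymptotics.isLittleO_pow_id one_lt_two
  · refine le_of_tendsto (((hD' y).sub (hD' x)).abs) ?_
    filter_upwards [hd] with i hi using hi.2 x y

/-- four derivatives, all of them `K`-Lipschitz -/
structure Reg (K : ℝ) (f : ℕ → ℝ → ℝ) : Prop where
  der : ∀ j < 4, ∀ x, HasDerivAt (f j) (f (j + 1) x) x
  lip : ∀ j ≤ 4, ∀ x y, |f j y - f j x| ≤ K * |y - x|

open Topology in
lemma limit_chain {ι : Type*} {l : Filter ι} [l.NeBot] {f : ι → ℕ → ℝ → ℝ} {G : ℝ → ℝ} {K : ℝ}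
    (hf : ∀ᶠ i in l, Reg K (f i)) (hlim : ∀ x, Tendsto (fun i => f i 0 x) l (𝓝 (G x))) :
    ∃ φ : ℕ → ℝ → ℝ, φ 0 = G ∧ Reg K φ ∧
      ∀ j ≤ 4, ∀ x, Tendsto (fun i => f i j x) l (𝓝 (φ j x)) := by
  have key : ∀ j < 4, ∀ G : ℝ → ℝ, (∀ x, Tendsto (fun i => f i j x) l (𝓝 (G x))) →
    ∃ D : ℝ → ℝ, (∀ x, HasDerivAt G (D x) x) ∧ (∀ x, Tendsto (fun i => f i (j + 1) x) l (𝓝 (D x))) := by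
    intro j hj G hG
    obtain ⟨D, h1, h2, -⟩ := conv_lemma (l := l) (g := fun i => f i j) (g' := fun i => f i (j + 1))
      (K := K) (by filter_upwards [hf] with i hi using ⟨hi.der j hj, hi.lip (j + 1) (by omega)⟩) hG
    exact ⟨D, h1, h2⟩
  obtain ⟨D1, a1, b1⟩ := key 0 (by norm_num) G hlim
  obtain ⟨D2, a2, b2⟩ := key 1 (by norm_num) D1 b1
  obtain ⟨D3, a3, b3⟩ := key 2 (by norm_num) D2 b2
  obtain ⟨D4, a4, b4⟩ := key 3 (by norm_num) D3 b3
  set φ : ℕ → ℝ → ℝ := fun j => match j with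
    | 0 => G | 1 => D1 | 2 => D2 | 3 => D3 | _ => D4 with hφ
  have ht : ∀ j ≤ 4, ∀ x, Tendsto (fun i => f i j x) l (𝓝 (φ j x)) := by
    intro j hj x
    interval_cases j
    exacts [hlim x, b1 x, b2 x, b3 x, b4 x]
  refine ⟨φ, rfl, ⟨?_, ?_⟩, ht⟩
  · intro j hj x
    interval_cases j
    exacts [a1 x, a2 x, a3 x, a4 x]
  · intro j hj x y
    refine le_of_tendsto (((ht j hj y).sub (ht j hj x)).abs) ?_
    filter_upwards [hf] with i hi using hi.lip j hj x y

lemma Reg.iter {K : ℝ} {f : ℕ → ℝ → ℝ} (h : Reg K f) : ∀ j ≤ 4, iteratedDeriv j (f 0) = f j := by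
  intro j
  induction j with
  | zero => intro _; exact iteratedDeriv_zero
  | succ j ih =>
    intro hj
    rw [iteratedDeriv_succ, ih (by omega)]
    exact funext fun x => (h.der j (by omega) x).deriv

lemma Reg.cont {K : ℝ} {f : ℕ → ℝ → ℝ} (h : Reg K f) (j : ℕ) (hj : j ≤ 4) : Continuous (f j) := by
  have : LipschitzWith (Real.toNNReal K) (f j) := by
    refine LipschitzWith.of_dist_le_mul fun x y => ?_
    have hK0 : 0 ≤ K := by
      have := (abs_nonneg _).trans (h.lip 0 (by norm_num) 0 1); simpa using this
    rw [Real.coe_toNNReal _ hK0, Real.dist_eq, Real.dist_eq]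
    exact h.lip j hj y x
  exact this.continuous

lemma Reg.contDiff {K : ℝ} {f : ℕ → ℝ → ℝ} (h : Reg K f) : ContDiff ℝ 4 (f 0) := by
  have := (contDiff_nat_iff_iteratedDeriv (𝕜 := ℝ) (n := 4) (f := f 0)).2 ⟨fun j hj => ?_, fun j hj => ?_⟩
  · exact this
  · rw [h.iter j hj]; exact h.cont j hj
  · rw [h.iter j hj.le]; exact fun x => (h.der j hj x).differentiableAt

section xi

lemma xi_term_bound (β : ℕ → ℝ) (p : ℕ) {s : ℝ} (hs : s ∈ Icc (0 : ℝ) 1) :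
    ‖(p : ℝ) * β p ^ 2 * s ^ (p - 1)‖ ≤ 2 ^ p * β p ^ 2 := by
  have h1 : s ^ (p - 1) ≤ 1 := pow_le_one₀ hs.1 hs.2
  have h0 : 0 ≤ s ^ (p - 1) := pow_nonneg hs.1 _
  have hp : (p : ℝ) ≤ 2 ^ p := by exact_mod_cast Nat.lt_two_pow_self.le
  rw [Real.norm_eq_abs, abs_of_nonneg (by positivity)]
  calc (p : ℝ) * β p ^ 2 * s ^ (p - 1) ≤ (p : ℝ) * β p ^ 2 * 1 :=
        mul_le_mul_of_nonneg_left h1 (by positivity)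
    _ ≤ _ := by rw [mul_one]; exact mul_le_mul_of_nonneg_right hp (sq_nonneg _)

variable {β : ℕ → ℝ}

lemma xi_summable (hβ : ValidBeta β) {s : ℝ} (hs : s ∈ Icc (0 : ℝ) 1) :
    Summable fun p : ℕ => (p : ℝ) * β p ^ 2 * s ^ (p - 1) :=
  Summable.of_norm_bounded hβ.2.2.2.2 fun p => xi_term_bound β p hs

lemma xi_cont (hβ : ValidBeta β) : ContinuousOn (xiD β) (Icc 0 1) := by
  refine continuousOn_tsum (fun p => ?_) hβ.2.2.2.2 fun p s hs => xi_term_bound β p hs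
  fun_prop

lemma xi_mono (hβ : ValidBeta β) : MonotoneOn (xiD β) (Icc 0 1) := by
  intro s hs t ht hst
  refine Summable.tsum_le_tsum (fun p => ?_) (xi_summable hβ hs) (xi_summable hβ ht)
  exact mul_le_mul_of_nonneg_left (pow_le_pow_left₀ hs.1 hst _) (by positivity)

lemma xi_nonneg (s : ℝ) (hs : s ∈ Icc (0 : ℝ) 1) : 0 ≤ xiD β s :=
  tsum_nonneg fun p => by have := hs.1; positivity
end xi

section atom
variable {ν : Measure ℝ}

lemma distF_mono_s10 (hν : MemM ν) : Monotone (distF ν) := by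
  have := hν.1
  intro s t hst
  exact measureReal_mono (μ := ν) (Icc_subset_Icc_right hst)

lemma distF_le_one_s10 (hν : MemM ν) (s : ℝ) : distF ν s ≤ 1 := by
  have := hν.1
  exact measureReal_le_one (μ := ν)

lemma distF_nonneg (s : ℝ) : 0 ≤ distF ν s := ENNReal.toReal_nonneg

lemma distF_one (hν : MemM ν) : distF ν 1 = 1 := by
  have := hν.1
  have h : ν (Icc (0 : ℝ) 1) = 1 := (prob_compl_eq_zero_iff measurableSet_Icc).1 hν.2
  simp [distF, h]

lemma distF_pos (hν : MemM ν) (h0 : ν {0} ≠ 0) {s : ℝ} (hs : 0 ≤ s) : 0 < distF ν s := by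
  have := hν.1
  refine ENNReal.toReal_pos (fun h => h0 ?_) (measure_ne_top _ _)
  exact measure_mono_null (singleton_subset_iff.2 (left_mem_Icc.2 hs)) h

lemma next_spec {S : Finset ℝ} (hS : ν ((S : Set ℝ))ᶜ = 0) {s : ℝ} (hs : s < 1) :
    s < nextPt ν s ∧ nextPt ν s ≤ 1 ∧ (nextPt ν s = 1 ∨ nextPt ν s ∈ S) ∧
    ∀ r ∈ Ico s (nextPt ν s), nextPt ν r = nextPt ν s ∧ (0 ≤ s → distF ν r = distF ν s) := by
  have memS : ∀ q, ν {q} ≠ 0 → q ∈ S := by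
    intro q hq
    by_contra h
    exact hq (measure_mono_null (singleton_subset_iff.2 (by simpa using h)) hS)
  set A : ℝ → Set ℝ := fun s => {q : ℝ | s < q ∧ q ≤ 1 ∧ ν {q} ≠ 0} ∪ {1} with hA
  have hfin : ∀ s, (A s).Finite := by
    intro s
    refine Set.Finite.union (S.finite_toSet.subset ?_) (finite_singleton _)
    intro q hq
    exact memS q hq.2.2
  have hne : ∀ s, (A s).Nonempty := fun s => ⟨1, Or.inr rfl⟩
  have hmem : nextPt ν s ∈ A s := (hne s).csInf_mem (hfin s)
  have hle : ∀ r, ∀ q ∈ A r, nextPt ν r ≤ q := fun r q hq => csInf_le (hfin r).bddBelow hq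
  set t := nextPt ν s with ht
  have hst : s < t := by
    rcases hmem with h | h
    · exact h.1
    · rw [mem_singleton_iff] at h; rw [h]; exact hs
  refine ⟨hst, hle s 1 (Or.inr rfl), ?_, ?_⟩
  · rcases hmem with h | h
    · exact Or.inr (memS _ h.2.2)
    · exact Or.inl h
  · intro r hr
    refine ⟨le_antisymm ?_ ?_, fun h0 => ?_⟩
    · refine hle r t ?_
      rcases hmem with h | h
      · exact Or.inl ⟨hr.2, h.2⟩
      · exact Or.inr h
    · refine hle s _ ?_
      rcases (hne r).csInf_mem (hfin r) with h | h
      · exact Or.inl ⟨lt_of_le_of_lt hr.1 h.1, h.2⟩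
      · exact Or.inr h
    · have hnull : ν (Ioc s r) = 0 := by
        have hsub : Ioc s r ⊆ (S : Set ℝ)ᶜ ∪ ⋃ q ∈ S.filter (fun q => q ∈ Ioc s r), {q} := by
          intro q hq
          by_cases hqS : q ∈ S
          · right; simp only [mem_iUnion]; exact ⟨q, by simp [hqS, hq.1, hq.2], rfl⟩
          · left; simpa using hqS
        refine measure_mono_null hsub (measure_union_null hS ?_)
        refine (measure_biUnion_null_iff (Finset.countable_toSet (S.filter fun q => q ∈ Ioc s r))).2 ?_
        intro q hq
        by_contra hq0
        have hq' := (Finset.mem_filter.1 (Finset.mem_coe.1 hq)).2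
        by_cases h1 : q ≤ 1
        · have := hle s q (Or.inl ⟨hq'.1, h1, hq0⟩)
          exact absurd hq'.2 (not_le.2 (hr.2.trans_le this))
        · have := hle s 1 (Or.inr rfl)
          exact h1 (hq'.2.trans (hr.2.le.trans this))
      unfold distF
      congr 1
      refine le_antisymm ?_ (measure_mono (Icc_subset_Icc_right hr.1))
      rw [← Icc_union_Ioc_eq_Icc h0 hr.1]
      refine (measure_union_le _ _).trans ?_
      rw [hnull, add_zero]

lemma cont_sigma {F : ℝ → ℝ} (h : Grow F) (x M : ℝ) :
    ContinuousOn (fun σ => ∫ z, F (x + z * σ) ∂γ) (Icc 0 M) := by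
  refine continuousOn_of_dominated (bound := fun z => F x * exp (M * |z|)) ?_ ?_ ?_ ?_
  · exact fun σ _ => (h.int0 x σ).1
  · intro σ hσ
    refine ae_of_all _ fun z => ?_
    rw [Real.norm_eq_abs, abs_of_pos (h.pos _)]
    refine (h.bd x σ z).trans (mul_le_mul_of_nonneg_left (exp_le_exp.2 ?_) (h.pos x).le)
    rw [abs_of_nonneg hσ.1]
    exact mul_le_mul_of_nonneg_right hσ.2 (abs_nonneg z)
  · exact (int_exp_abs M).const_mul _
  · refine ae_of_all _ fun z => ?_
    have := h.cont
    fun_prop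

lemma atomic_good {β : ℕ → ℝ} (hβ : ValidBeta β) (hν : MemM ν) (h0 : ν {0} ≠ 0) {S : Finset ℝ}
    (hS : ν ((S : Set ℝ))ᶜ = 0) {Φ : ℝ → ℝ → ℝ} (hΦ : IsAtomicSol β ν Φ) :
    ∀ n : ℕ, ∀ s ∈ Icc (0 : ℝ) 1, (S.filter (fun q => s < q)).card = n →
      (∃ f : ℕ → ℝ → ℝ, f 0 = Φ s ∧
        Good (distF ν s) (exp (-(cK (xiD β 1) * (xiD β 1 - xiD β s)))) f) ∧
      ∀ x, ContinuousOn (fun r => Φ r x) (Icc s 1) := by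
  have base : (∃ f : ℕ → ℝ → ℝ, f 0 = Φ 1 ∧
        Good (distF ν 1) (exp (-(cK (xiD β 1) * (xiD β 1 - xiD β 1)))) f) ∧
      ∀ x, ContinuousOn (fun r => Φ r x) (Icc 1 1) := by
    obtain ⟨f, hf, hg⟩ := good_base
    refine ⟨⟨f, funext fun x => by rw [hf, hΦ.1], ?_⟩, fun x => ?_⟩
    · rw [distF_one hν]; simpa using hg
    · rw [Icc_self]; exact continuousOn_singleton _ _
  intro n
  induction n using Nat.strong_induction_on with
  | _ n ih =>
  intro s hs hn
  rcases eq_or_lt_of_le hs.2 with rfl | hs1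
  · exact base
  obtain ⟨hst, ht1, htS, hr⟩ := next_spec hS hs1
  set t := nextPt ν s with ht
  have htI : t ∈ Icc (0 : ℝ) 1 := ⟨hs.1.trans hst.le, ht1⟩
  have hPt : (∃ f : ℕ → ℝ → ℝ, f 0 = Φ t ∧
        Good (distF ν t) (exp (-(cK (xiD β 1) * (xiD β 1 - xiD β t)))) f) ∧
      ∀ x, ContinuousOn (fun r => Φ r x) (Icc t 1) := by
    rcases htS with h1 | h1
    · rw [h1]; exact base
    · refine ih _ ?_ t htI rfl
      rw [← hn]
      refine Finset.card_lt_card (Finset.ssubset_iff_of_subset ?_ |>.2 ⟨t, ?_, ?_⟩)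
      · intro q hq
        rw [Finset.mem_filter] at hq ⊢
        exact ⟨hq.1, hst.trans hq.2⟩
      · rw [Finset.mem_filter]; exact ⟨h1, hst⟩
      · simp
  obtain ⟨⟨f, hf0, hgood⟩, hcont⟩ := hPt
  set m := distF ν s with hm
  have hm0 : 0 < m := distF_pos hν h0 hs.1
  have hm1 : m ≤ 1 := distF_le_one_s10 hν s
  have hg := hgood.mono (exp_pos _).le hm0 (distF_mono_s10 hν hst.le) (distF_le_one_s10 hν t)
  have hxi : ∀ r ∈ Icc s t, r ∈ Icc (0 : ℝ) 1 := fun r hr => ⟨hs.1.trans hr.1, hr.2.trans ht1⟩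
  have one_mem : (1 : ℝ) ∈ Icc (0 : ℝ) 1 := ⟨zero_le_one, le_rfl⟩
  have hform : ∀ r ∈ Ico s t, ∀ x, Φ r x =
      m⁻¹ * log (∫ z, exp (m * f 0 (x + z * √(xiD β t - xiD β r))) ∂γ) := by
    intro r hrr x
    rw [hΦ.2 r ⟨hs.1.trans hrr.1, hrr.2.trans_le ht1⟩ x, (hr r hrr).1, (hr r hrr).2 hs.1, hf0]
    unfold gStep
    rw [if_neg hm0.ne']
  have hv : 0 ≤ xiD β t - xiD β s := sub_nonneg.2 (xi_mono hβ hs htI hst.le)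
  have hvV : xiD β t - xiD β s ≤ xiD β 1 := by
    have := xi_mono hβ htI one_mem ht1
    have := xi_nonneg (β := β) s hs
    linarith
  constructor
  · obtain ⟨g, hg0, hgg⟩ := good_step hg (exp_pos _).le hm0 hm1 hv hvV
    refine ⟨g, funext fun x => ?_, ?_⟩
    · rw [hg0, hform s ⟨le_rfl, hst⟩]
    · convert hgg using 1
      rw [← exp_add]; congr 1; ring
  · intro x
    have hG := hg.grow hm0 hm1
    have hc1 : ContinuousOn (fun r => Φ r x) (Icc s t) := by
      have c1 : ContinuousOn (fun r => √(xiD β t - xiD β r)) (Icc s t) :=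
        ((continuousOn_const.sub ((xi_cont hβ).mono hxi))).sqrt
      have c2 : ContinuousOn (fun r => ∫ z, exp (m * f 0 (x + z * √(xiD β t - xiD β r))) ∂γ)
          (Icc s t) := by
        refine (cont_sigma hG x (√(xiD β 1))).comp c1 fun r hrr => ⟨Real.sqrt_nonneg _, ?_⟩
        refine Real.sqrt_le_sqrt ?_
        have := xi_mono hβ htI one_mem ht1
        have := xi_nonneg (β := β) r (hxi r hrr)
        linarith
      have c3 : ContinuousOn (fun r => m⁻¹ * log (∫ z, exp (m * f 0 (x + z * √(xiD β t - xiD β r))) ∂γ))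
          (Icc s t) := by
        refine continuousOn_const.mul (c2.log fun r _ => ?_)
        exact (integral_exp_pos (hG.int0 x _)).ne'
      refine c3.congr fun r hrr => ?_
      rcases eq_or_lt_of_le hrr.2 with h | h
      · simp only [h, sub_self, Real.sqrt_zero, mul_zero, add_zero, integral_const, probReal_univ, one_smul, log_exp, hf0]
        field_simp
      · exact hform r ⟨hrr.1, h⟩ x
    rw [← Icc_union_Icc_eq_Icc hst.le ht1]
    exact hc1.union_of_isClosed (hcont x) isClosed_Icc isClosed_Icc
end atom

section approx

/-- Rounding up to the grid of mesh `1 / (n + 1)`. -/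
def gridUp (n : ℕ) (r : ℝ) : ℝ := (⌈((n : ℝ) + 1) * r⌉ : ℝ) / ((n : ℝ) + 1)

lemma gridUp_meas (n : ℕ) : Measurable (gridUp n) := by
  unfold gridUp
  have h : Measurable (fun r : ℝ => ((⌈((n : ℝ) + 1) * r⌉ : ℤ) : ℝ)) :=
    (measurable_from_top (f := fun k : ℤ => (k : ℝ))).comp
      (Int.measurable_ceil.comp (measurable_const.mul measurable_id))
  exact h.div_const _

lemma gridUp_ge (n : ℕ) (r : ℝ) : r ≤ gridUp n r := by
  have hN : (0 : ℝ) < (n : ℝ) + 1 := by positivity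
  unfold gridUp
  rw [le_div_iff₀ hN, mul_comm]
  exact Int.le_ceil _

lemma gridUp_lt (n : ℕ) (r : ℝ) : gridUp n r < r + 1 / ((n : ℝ) + 1) := by
  have hN : (0 : ℝ) < (n : ℝ) + 1 := by positivity
  unfold gridUp
  have h := Int.ceil_lt_add_one (((n : ℝ) + 1) * r)
  rw [div_lt_iff₀ hN]
  refine h.trans_eq ?_
  field_simp

/-- The grid. -/
def grid (n : ℕ) : Finset ℝ := (Finset.range (n + 2)).image fun k : ℕ => (k : ℝ) / ((n : ℝ) + 1)

lemma gridUp_mem (n : ℕ) {r : ℝ} (hr : r ∈ Icc (0 : ℝ) 1) : gridUp n r ∈ grid n := by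
  have hN : (0 : ℝ) < (n : ℝ) + 1 := by positivity
  unfold grid
  rw [Finset.mem_image]
  have h0 : 0 ≤ ⌈((n : ℝ) + 1) * r⌉ := Int.ceil_nonneg (mul_nonneg hN.le hr.1)
  have h1 : ⌈((n : ℝ) + 1) * r⌉ ≤ (n : ℤ) + 1 := by
    rw [Int.ceil_le]; push_cast; nlinarith [hr.2]
  obtain ⟨k, hk⟩ := Int.eq_ofNat_of_zero_le h0
  refine ⟨k, Finset.mem_range.2 (by omega), ?_⟩
  unfold gridUp
  rw [hk]; simp

lemma grid_sub (n : ℕ) : (grid n : Set ℝ) ⊆ Icc 0 1 := by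
  have hN : (0 : ℝ) < (n : ℝ) + 1 := by positivity
  intro q hq
  obtain ⟨k, hk, rfl⟩ := Finset.mem_image.1 (Finset.mem_coe.1 hq)
  have hk' : (k : ℝ) ≤ (n : ℝ) + 1 := by
    have := Finset.mem_range.1 hk
    exact_mod_cast (by omega : k ≤ n + 1)
  exact ⟨by positivity, (div_le_one hN).2 hk'⟩

lemma zero_mem_grid (n : ℕ) : (0 : ℝ) ∈ grid n :=
  Finset.mem_image.2 ⟨0, by simp, by simp⟩

/-- The approximating atomic measures. -/
def appr (μ : Measure ℝ) (n : ℕ) : Measure ℝ :=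
  ((n : ENNReal) + 1)⁻¹ • Measure.dirac 0 +
    ((n : ENNReal) * ((n : ENNReal) + 1)⁻¹) • Measure.map (gridUp n) μ

variable {μ : Measure ℝ}

lemma appr_grid (hμ : MemM μ) (n : ℕ) : appr μ n ((grid n : Set ℝ))ᶜ = 0 := by
  have hm : MeasurableSet ((grid n : Set ℝ))ᶜ := (grid n).measurableSet.compl
  have h1 : Measure.map (gridUp n) μ ((grid n : Set ℝ))ᶜ = 0 := by
    rw [Measure.map_apply (gridUp_meas n) hm]
    refine measure_mono_null (fun r hr => ?_) hμ.2
    intro hr'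
    exact hr (Finset.mem_coe.2 (gridUp_mem n hr'))
  have h2 : Measure.dirac (0 : ℝ) ((grid n : Set ℝ))ᶜ = 0 := by
    rw [Measure.dirac_apply' _ hm]
    simp [zero_mem_grid]
  simp only [appr, Measure.add_apply, Measure.smul_apply, h1, h2, smul_zero, add_zero]

lemma appr_memM (hμ : MemM μ) (n : ℕ) : MemM (appr μ n) := by
  have := hμ.1
  have := Measure.isProbabilityMeasure_map (μ := μ) (gridUp_meas n).aemeasurable
  refine ⟨⟨?_⟩, measure_mono_null (compl_subset_compl.2 (grid_sub n)) (appr_grid hμ n)⟩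
  simp only [appr, Measure.add_apply, Measure.smul_apply, measure_univ, smul_eq_mul, mul_one]
  rw [add_comm, ← add_one_mul]
  exact ENNReal.mul_inv_cancel (by simp) (by finiteness)

lemma appr_zero (n : ℕ) : appr μ n {0} ≠ 0 := by
  simp only [appr, Measure.add_apply, Measure.smul_apply, smul_eq_mul]
  have : ((n : ENNReal) + 1)⁻¹ ≠ 0 := ENNReal.inv_ne_zero.2 (by finiteness)
  simp

lemma appr_distF (hμ : MemM μ) (n : ℕ) {s : ℝ} (hs : 0 ≤ s) :
    distF (appr μ n) s =
      ((n : ℝ) + 1)⁻¹ + (n : ℝ) * ((n : ℝ) + 1)⁻¹ * distF (Measure.map (gridUp n) μ) s := by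
  have := hμ.1
  have := Measure.isProbabilityMeasure_map (μ := μ) (gridUp_meas n).aemeasurable
  have hd : Measure.dirac (0 : ℝ) (Icc 0 s) = 1 :=
    Measure.dirac_apply_of_mem (left_mem_Icc.2 hs)
  have hi : ((n : ENNReal) + 1)⁻¹ ≠ ⊤ := ENNReal.inv_ne_top.2 (by simp)
  have ht : (((n : ENNReal) + 1)⁻¹).toReal = ((n : ℝ) + 1)⁻¹ := by
    rw [ENNReal.toReal_inv, ENNReal.toReal_add (by finiteness) (by finiteness)]; simp
  unfold distF
  simp only [appr, Measure.add_apply, Measure.smul_apply, smul_eq_mul, hd, mul_one]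
  rw [ENNReal.toReal_add hi (by finiteness)]
  simp only [ENNReal.toReal_mul, ht, ENNReal.toReal_natCast]

lemma map_distF_le (hμ : MemM μ) (n : ℕ) (s : ℝ) :
    distF (Measure.map (gridUp n) μ) s ≤ distF μ s := by
  have := hμ.1
  unfold distF
  refine ENNReal.toReal_mono (measure_ne_top _ _) ?_
  rw [Measure.map_apply (gridUp_meas n) measurableSet_Icc]
  have hsub : gridUp n ⁻¹' Icc 0 s ⊆ Icc 0 s ∪ (Icc 0 1)ᶜ := by
    intro r hr
    by_cases h : r ∈ Icc (0 : ℝ) 1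
    · exact Or.inl ⟨h.1, (gridUp_ge n r).trans hr.2⟩
    · exact Or.inr h
  refine (measure_mono hsub).trans ((measure_union_le _ _).trans ?_)
  rw [hμ.2, add_zero]

lemma le_map_distF (hμ : MemM μ) (n : ℕ) (s : ℝ) :
    distF μ (s - 1 / ((n : ℝ) + 1)) ≤ distF (Measure.map (gridUp n) μ) s := by
  have := hμ.1
  have := Measure.isProbabilityMeasure_map (μ := μ) (gridUp_meas n).aemeasurable
  unfold distF
  refine ENNReal.toReal_mono (measure_ne_top _ _) ?_
  rw [Measure.map_apply (gridUp_meas n) measurableSet_Icc]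
  refine measure_mono fun r hr => ⟨hr.1.trans (gridUp_ge n r), ?_⟩
  have := gridUp_lt n r
  have := hr.2
  linarith

lemma appr_tendsto_pt (hμ : MemM μ) {s : ℝ} (hs : 0 ≤ s) (hc : ContinuousAt (distF μ) s) :
    Tendsto (fun n => distF (appr μ n) s) atTop (nhds (distF μ s)) := by
  have h0 : Tendsto (fun n : ℕ => 1 / ((n : ℝ) + 1)) atTop (nhds 0) :=
    tendsto_one_div_add_atTop_nhds_zero_nat
  have h1 : Tendsto (fun n : ℕ => distF μ (s - 1 / ((n : ℝ) + 1))) atTop (nhds (distF μ s)) := by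
    refine hc.tendsto.comp ?_
    simpa using h0.const_sub s
  have h2 : Tendsto (fun n : ℕ => distF (Measure.map (gridUp n) μ) s) atTop (nhds (distF μ s)) :=
    tendsto_of_tendsto_of_tendsto_of_le_of_le h1 tendsto_const_nhds
      (fun n => le_map_distF hμ n s) (fun n => map_distF_le hμ n s)
  have h3 : Tendsto (fun n : ℕ => ((n : ℝ) + 1)⁻¹ +
      (1 - ((n : ℝ) + 1)⁻¹) * distF (Measure.map (gridUp n) μ) s) atTop
      (nhds (0 + (1 - 0) * distF μ s)) := by
    simp only [one_div] at h0
    exact h0.add ((h0.const_sub 1).mul h2)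
  simp only [zero_add, sub_zero, one_mul] at h3
  refine h3.congr fun n => ?_
  rw [appr_distF hμ n hs]
  have hN : (n : ℝ) + 1 ≠ 0 := by positivity
  field_simp
  ring

lemma appr_tendsto (hμ : MemM μ) : Tendsto (fun n => dM μ (appr μ n)) atTop (nhds 0) := by
  have h : Tendsto (fun n => dM μ (appr μ n)) atTop (nhds (∫ s in (0 : ℝ)..1, (0 : ℝ))) := by
    refine intervalIntegral.tendsto_integral_filter_of_dominated_convergence (fun _ => 1) ?_ ?_ ?_ ?_
    · refine Eventually.of_forall fun n => ?_
      exact (((distF_mono_s10 hμ).measurable.sub (distF_mono_s10 (appr_memM hμ n)).measurable).norm).aestronglyMeasurable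
    · refine Eventually.of_forall fun n => ae_of_all _ fun s _ => ?_
      have a1 := distF_le_one_s10 hμ s
      have a2 := distF_le_one_s10 (appr_memM hμ n) s
      have a3 := distF_nonneg (ν := μ) s
      have a4 := distF_nonneg (ν := appr μ n) s
      rw [Real.norm_eq_abs, abs_abs, abs_le]
      constructor <;> linarith
    · exact intervalIntegrable_const
    · have hae := (distF_mono_s10 hμ).countable_not_continuousAt.ae_notMem volume
      filter_upwards [hae] with s hs hs1
      rw [uIoc_of_le zero_le_one] at hs1
      have hc : ContinuousAt (distF μ) s := by simpa using hs
      have := ((appr_tendsto_pt hμ hs1.1.le hc).const_sub (distF μ s)).abs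
      simpa using this
  simpa using h
end approx

section final
variable {β : ℕ → ℝ} {Φ : Measure ℝ → ℝ → ℝ → ℝ} {μ : Measure ℝ}

lemma Good.reg {m c : ℝ} {f : ℕ → ℝ → ℝ} (h : Good m c f) (hc : 0 ≤ c) (hm : 0 < m)
    (hm1 : m ≤ 1) : Reg 2000 f := by
  refine ⟨fun j hj => h.der j (by omega), fun j hj x y => ?_⟩
  refine hasDeriv_lip (h.der j (by omega)) (fun u => ?_) x y
  have h1 := h.b1 u
  have h2 := h.f2_abs hc hm u
  have h3 := h.f3 hc hm hm1 u
  have h4 := h.f4 hc hm hm1 u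
  have h5 := h.f5 hc hm hm1 u
  interval_cases j <;> norm_num only <;> linarith

lemma appr_unif (hΦ : IsParisiFamily β Φ) (hμ : MemM μ) {ε : ℝ} (hε : 0 < ε) :
    ∀ᶠ n in atTop, ∀ s ∈ Icc (0 : ℝ) 1, ∀ x : ℝ, |Φ μ s x - Φ (appr μ n) s x| < ε := by
  obtain ⟨δ, hδ, h⟩ := hΦ.2 μ hμ ε hε
  filter_upwards [(appr_tendsto hμ).eventually (gt_mem_nhds hδ)] with n hn
  exact h _ (appr_memM hμ n) hn

lemma phi_tendsto (hΦ : IsParisiFamily β Φ) (hμ : MemM μ) {s : ℝ} (hs : s ∈ Icc (0 : ℝ) 1)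
    (x : ℝ) : Tendsto (fun n => Φ (appr μ n) s x) atTop (nhds (Φ μ s x)) := by
  rw [Metric.tendsto_nhds]
  intro ε hε
  filter_upwards [appr_unif hΦ hμ hε] with n hn
  rw [dist_comm, Real.dist_eq]
  exact hn s hs x

lemma phi_cont (hβ : ValidBeta β) (hΦ : IsParisiFamily β Φ) (hμ : MemM μ) (x : ℝ) :
    ContinuousOn (fun s => Φ μ s x) (Icc 0 1) := by
  have hu : TendstoUniformlyOn (fun n s => Φ (appr μ n) s x) (fun s => Φ μ s x) atTop
      (Icc (0 : ℝ) 1) := by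
    rw [Metric.tendstoUniformlyOn_iff]
    intro ε hε
    filter_upwards [appr_unif hΦ hμ hε] with n hn s hs
    rw [Real.dist_eq]
    exact hn s hs x
  refine hu.continuousOn (Frequently.of_forall fun n => ?_)
  have hA := hΦ.1 _ (appr_memM hμ n) ⟨grid n, appr_grid hμ n⟩
  exact (atomic_good hβ (appr_memM hμ n) (appr_zero n) (appr_grid hμ n) hA _ 0
    ⟨le_rfl, zero_le_one⟩ rfl).2 x

lemma phi_reg (hβ : ValidBeta β) (hΦ : IsParisiFamily β Φ) (hμ : MemM μ) {s : ℝ}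
    (hs : s ∈ Icc (0 : ℝ) 1) : ∃ φ : ℕ → ℝ → ℝ, φ 0 = Φ μ s ∧ Reg 2000 φ ∧
      ∀ x, |φ 1 x| ≤ 1 ∧ exp (-(cK (xiD β 1) * xiD β 1)) / Real.cosh x ^ 2 ≤ φ 2 x ∧ φ 2 x ≤ 1 ∧
        |φ 3 x| ≤ 4 := by
  have hex : ∀ n, ∃ f : ℕ → ℝ → ℝ, f 0 = Φ (appr μ n) s ∧
      Good (distF (appr μ n) s) (exp (-(cK (xiD β 1) * (xiD β 1 - xiD β s)))) f := by
    intro n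
    have hA := hΦ.1 _ (appr_memM hμ n) ⟨grid n, appr_grid hμ n⟩
    exact (atomic_good hβ (appr_memM hμ n) (appr_zero n) (appr_grid hμ n) hA _ s hs rfl).1
  choose f hf0 hf using hex
  have hm : ∀ n, 0 < distF (appr μ n) s := fun n => distF_pos (appr_memM hμ n) (appr_zero n) hs.1
  have hm1 : ∀ n, distF (appr μ n) s ≤ 1 := fun n => distF_le_one_s10 (appr_memM hμ n) s
  obtain ⟨φ, hφ0, hφ, hlim⟩ := limit_chain (l := atTop) (f := f) (G := Φ μ s) (K := 2000)
    (Eventually.of_forall fun n => (hf n).reg (exp_pos _).le (hm n) (hm1 n))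
    (fun x => by simp only [hf0]; exact phi_tendsto hΦ hμ hs x)
  refine ⟨φ, hφ0, hφ, fun x => ⟨?_, ?_, ?_, ?_⟩⟩
  · exact le_of_tendsto (hlim 1 (by norm_num) x).abs (Eventually.of_forall fun n => (hf n).b1 x)
  · refine ge_of_tendsto (hlim 2 (by norm_num) x) (Eventually.of_forall fun n => ?_)
    refine le_trans ?_ ((hf n).low x)
    refine div_le_div_of_nonneg_right (exp_le_exp.2 (neg_le_neg ?_)) (sq_nonneg _)
    refine mul_le_mul_of_nonneg_left ?_ (cK_nonneg _)
    have := xi_nonneg (β := β) s hs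
    linarith
  · exact le_of_tendsto (hlim 2 (by norm_num) x)
      (Eventually.of_forall fun n => (hf n).f2_le (hm n) x)
  · exact le_of_tendsto (hlim 3 (by norm_num) x).abs
      (Eventually.of_forall fun n => (hf n).f3 (exp_pos _).le (hm n) (hm1 n) x)

lemma phi_reg' (hβ : ValidBeta β) (hΦ : IsParisiFamily β Φ) (hμ : MemM μ) {s : ℝ}
    (hs : s ∈ Icc (0 : ℝ) 1) : Reg 2000 (fun j => iteratedDeriv j (Φ μ s)) := by
  obtain ⟨φ, h0, hφ, -⟩ := phi_reg hβ hΦ hμ hs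
  have hi := hφ.iter
  rw [h0] at hi
  refine ⟨fun j hj x => ?_, fun j hj x y => ?_⟩
  · simp only [hi j hj.le, hi (j + 1) (by omega)]
    exact hφ.der j hj x
  · simp only [hi j hj]
    exact hφ.lip j hj x y

lemma phi_joint (hβ : ValidBeta β) (hΦ : IsParisiFamily β Φ) (hμ : MemM μ) {j : ℕ} (hj : j ≤ 4) :
    ContinuousOn (fun p : ℝ × ℝ => iteratedDeriv j (Φ μ p.1) p.2)
      (Icc (0 : ℝ) 1 ×ˢ (univ : Set ℝ)) := by
  rintro ⟨s, x⟩ ⟨hs, -⟩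
  have hs' : s ∈ Icc (0 : ℝ) 1 := hs
  have : (nhdsWithin s (Icc (0 : ℝ) 1)).NeBot := mem_closure_iff_nhdsWithin_neBot.1 (subset_closure hs')
  obtain ⟨φ, hφ0, hφ, hlim⟩ := limit_chain (l := nhdsWithin s (Icc (0 : ℝ) 1))
    (f := fun r j => iteratedDeriv j (Φ μ r)) (G := Φ μ s) (K := 2000)
    (by filter_upwards [self_mem_nhdsWithin] with r hr using phi_reg' hβ hΦ hμ hr)
    (fun y => by simp only [iteratedDeriv_zero]; exact phi_cont hβ hΦ hμ y s hs')
  have hi := hφ.iter j hj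
  rw [hφ0] at hi
  have h1 := hlim j hj x
  rw [← hi] at h1
  have hfst : Tendsto (Prod.fst : ℝ × ℝ → ℝ) (nhdsWithin (s, x) (Icc (0 : ℝ) 1 ×ˢ univ))
      (nhdsWithin s (Icc 0 1)) := by
    refine tendsto_nhdsWithin_iff.2 ⟨continuous_fst.continuousWithinAt, ?_⟩
    filter_upwards [self_mem_nhdsWithin] with p hp using hp.1
  have h2 := h1.comp hfst
  have h3 : Tendsto (fun p : ℝ × ℝ => 2000 * |p.2 - x|)
      (nhdsWithin (s, x) (Icc (0 : ℝ) 1 ×ˢ univ)) (nhds 0) := by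
    have hc : Continuous (fun p : ℝ × ℝ => 2000 * |p.2 - x|) := by fun_prop
    have := (hc.tendsto (s, x)).mono_left (nhdsWithin_le_nhds (s := Icc (0 : ℝ) 1 ×ˢ univ))
    simpa using this
  have h4 : Tendsto (fun p : ℝ × ℝ => iteratedDeriv j (Φ μ p.1) p.2 - iteratedDeriv j (Φ μ p.1) x)
      (nhdsWithin (s, x) (Icc (0 : ℝ) 1 ×ˢ univ)) (nhds 0) := by
    refine squeeze_zero_norm' ?_ h3
    filter_upwards [self_mem_nhdsWithin] with p hp
    exact (phi_reg' hβ hΦ hμ hp.1).lip j hj x p.2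
  have h5 := h4.add h2
  rw [zero_add] at h5
  refine h5.congr fun p => ?_
  simp
end final

/-- **Regularity of the Parisi PDE solution (Proposition 2 (i),(ii)).**
(a) For `0 ≤ j ≤ 4`, `∂ₓʲ Φ_μ` exists and is continuous on `[0,1] × ℝ`;
(b) `|∂ₓ Φ_μ| ≤ 1`;
(c) there is `C > 0` depending only on `ξ` with `C/cosh² x ≤ ∂ₓₓ Φ_μ(s,x) ≤ 1`;
(d) `|∂ₓ³ Φ_μ| ≤ 4`. -/
theorem stmt10 (β : ℕ → ℝ) (hβ : ValidBeta β)
    (Φ : Measure ℝ → ℝ → ℝ → ℝ) (hΦ : IsParisiFamily β Φ) :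
    (∀ μ : Measure ℝ, MemM μ →
      (∀ s ∈ Icc (0 : ℝ) 1, ContDiff ℝ 4 (Φ μ s)) ∧
      (∀ j : ℕ, j ≤ 4 → ContinuousOn
        (fun p : ℝ × ℝ => iteratedDeriv j (Φ μ p.1) p.2)
        (Icc (0 : ℝ) 1 ×ˢ (univ : Set ℝ)))) ∧
    (∀ μ : Measure ℝ, MemM μ → ∀ s ∈ Icc (0 : ℝ) 1, ∀ x : ℝ,
      |deriv (Φ μ s) x| ≤ 1) ∧
    (∃ C : ℝ, 0 < C ∧ ∀ μ : Measure ℝ, MemM μ → ∀ s ∈ Icc (0 : ℝ) 1, ∀ x : ℝ,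
      C / (Real.cosh x) ^ 2 ≤ iteratedDeriv 2 (Φ μ s) x ∧
        iteratedDeriv 2 (Φ μ s) x ≤ 1) ∧
    (∀ μ : Measure ℝ, MemM μ → ∀ s ∈ Icc (0 : ℝ) 1, ∀ x : ℝ,
      |iteratedDeriv 3 (Φ μ s) x| ≤ 4) := by
  refine ⟨fun μ hμ => ⟨fun s hs => ?_, fun j hj => phi_joint hβ hΦ hμ hj⟩, fun μ hμ s hs x => ?_,
    ⟨exp (-(cK (xiD β 1) * xiD β 1)), exp_pos _, fun μ hμ s hs x => ?_⟩, fun μ hμ s hs x => ?_⟩ <;>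
    obtain ⟨φ, h0, hφ, hb⟩ := phi_reg hβ hΦ hμ hs <;> rw [← h0]
  · exact hφ.contDiff
  · rw [← iteratedDeriv_one, hφ.iter 1 (by norm_num)]
    exact (hb x).1
  · rw [hφ.iter 2 (by norm_num)]
    exact ⟨(hb x).2.1, (hb x).2.2.1⟩
  · rw [hφ.iter 3 (by norm_num)]
    exact (hb x).2.2.2

end
end
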